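/- arXiv:2404.05153 — 6 statements merged into one kernel-verified Lean document; each statement's English description precedes it below -/
import Mathlib

section
/- Let X and Y be length spaces and let D > 0 be a constant such that the Gromov–Hausdorff distance between X and Y is strictly less than D (equivalently, X and Y admit isometric copies in a common metric space at Hausdorff distance < D). Assume that every loop of diameter < 4D in X is nulhomotopic in X, and every loop of diameter < 4D in Y is nulhomotopic in Y. Then the fundamental groups π₁(X) and π₁(Y) are isomorphic. -/
open Real Set Metric
open scoped ENNReal unitInterval

noncomputable section

/-- A *length space*: the distance between any two points equals the infimum of the
lengths (total variations) of continuous paths joining them. -/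
def IsLengthSpace (X : Type*) [MetricSpace X] : Prop :=
  ∀ x y : X,
    ENNReal.ofReal (dist x y) =
      ⨅ γ ∈ {γ : ℝ → X | ContinuousOn γ (Set.Icc 0 1) ∧ γ 0 = x ∧ γ 1 = y},
        eVariationOn γ (Set.Icc 0 1)

/-- A *geodesic space*: any two points are joined by a path whose length equals
their distance. -/
def IsGeodesicSpace (X : Type*) [MetricSpace X] : Prop :=
  ∀ x y : X, ∃ γ : ℝ → X, ContinuousOn γ (Set.Icc 0 1) ∧ γ 0 = x ∧ γ 1 = y ∧
    eVariationOn γ (Set.Icc 0 1) = ENNReal.ofReal (dist x y)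

/-- A continuous map `γ : [0,1] → Y` is a loop if its endpoints agree. -/
def IsLoop {Y : Type*} [TopologicalSpace Y] (γ : C(unitInterval, Y)) : Prop := γ 0 = γ 1

/-- Two loops are homotopic *through loops* (free homotopy of loops). -/
def LoopHomotopic {Y : Type*} [TopologicalSpace Y] (γ γ' : C(unitInterval, Y)) : Prop :=
  ∃ H : C(unitInterval × unitInterval, Y),
    (∀ t, H (0, t) = γ t) ∧ (∀ t, H (1, t) = γ' t) ∧ ∀ s, H (s, 0) = H (s, 1)

/-- A loop is nulhomotopic if it is homotopic, through loops, to a constant loop. -/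
def IsNullLoop {Y : Type*} [TopologicalSpace Y] (γ : C(unitInterval, Y)) : Prop :=
  ∃ y : Y, LoopHomotopic γ (ContinuousMap.const _ y)

/-- A correspondence between `X` and `Y`: a relation whose two projections are surjective. -/
def IsCorrespondence {X Y : Type*} (R : Set (X × Y)) : Prop :=
  (∀ x : X, ∃ y : Y, (x, y) ∈ R) ∧ (∀ y : Y, ∃ x : X, (x, y) ∈ R)

/-- The distortion of a relation `R ⊆ X × Y`,
`dis R = sup {|d_X(x,x') − d_Y(y,y')| : (x,y), (x',y') ∈ R}` (in `ℝ≥0∞`). -/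
noncomputable def distortion {X Y : Type*} [MetricSpace X] [MetricSpace Y]
    (R : Set (X × Y)) : ℝ≥0∞ :=
  ⨆ (p : R) (q : R),
    ENNReal.ofReal |dist (p : X × Y).1 (q : X × Y).1 - dist (p : X × Y).2 (q : X × Y).2|

/-- The Gromov–Hausdorff distance, expressed as half the infimal distortion of
correspondences between `X` and `Y` (valued in `ℝ≥0∞`). -/
noncomputable def ghDist (X Y : Type*) [MetricSpace X] [MetricSpace Y] : ℝ≥0∞ :=
  (⨅ R : {R : Set (X × Y) // IsCorrespondence R}, distortion (R : Set (X × Y))) / 2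

/-- The circle of circumference `2π`, i.e. `ℝ/2πℤ`, with its intrinsic (quotient) metric. -/
abbrev IntrinsicCircle := AddCircle (2 * π)

instance : Fact ((0:ℝ) < 2 * π) := ⟨by positivity⟩

/-- The lengths `π/2, π/2, π/4` of the three legs of the tripod `E`. -/
def tripodLeg : Fin 3 → ℝ := ![π/2, π/2, π/4]

/-- The tripod `E`: three segments of lengths `π/2`, `π/2`, `π/4` glued at a common
endpoint (the origin), realized as a union of coordinate segments in `ℝ³` with the
`ℓ¹`-metric; the induced metric is exactly the path metric of the tripod. -/
def TripodSet : Set (PiLp 1 fun _ : Fin 3 => ℝ) :=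
  {p | ∃ (i : Fin 3) (t : ℝ), 0 ≤ t ∧ t ≤ tripodLeg i ∧
    p = (WithLp.equiv 1 (∀ _ : Fin 3, ℝ)).symm (fun j => if j = i then t else 0)}

/-- The tripod `E` as a metric space. -/
abbrev TripodE : Type := ↥TripodSet

/-- An arc from `x` to `y`: a subspace homeomorphic to `[0,1]`, with endpoints `x` and `y`. -/
def IsArcBetween {X : Type*} [TopologicalSpace X] (x y : X) (A : Set X) : Prop :=
  ∃ γ : C(unitInterval, X), Function.Injective γ ∧ γ 0 = x ∧ γ 1 = y ∧ Set.range γ = A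

/-- An `ℝ`-tree: every pair of distinct points is joined by a unique arc, and this arc
is a geodesic segment (isometric to a real interval). -/
def IsRTree (X : Type*) [MetricSpace X] : Prop :=
  ∀ x y : X, x ≠ y →
    (∃! A : Set X, IsArcBetween x y A) ∧
    ∀ A : Set X, IsArcBetween x y A →
      ∃ γ : ℝ → X, γ 0 = x ∧ γ (dist x y) = y ∧
        γ '' Set.Icc 0 (dist x y) = A ∧
        ∀ s ∈ Set.Icc 0 (dist x y), ∀ t ∈ Set.Icc 0 (dist x y), dist (γ s) (γ t) = |s - t|

/-- The length of an `ℝ`-tree: the supremum of sums of lengths of pairwise disjoint arcs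
contained in it.  (In an `ℝ`-tree every arc is a geodesic segment, so its length is its
diameter.) -/
noncomputable def treeLength (X : Type*) [MetricSpace X] : ℝ≥0∞ :=
  ⨆ (S : Finset (Set X)) (_ : (∀ A ∈ S, ∃ x y : X, x ≠ y ∧ IsArcBetween x y A) ∧
      (S : Set (Set X)).Pairwise Disjoint), ∑ A ∈ S, EMetric.diam A

universe u v


/-! ### Multiplicative homotopy invariants of paths -/

/-- A homotopy-invariant, multiplicative assignment of group elements to paths, i.e. a functor
from the fundamental groupoid to a group. -/
structure PathHom (X G : Type*) [TopologicalSpace X] [Group G] where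
  /-- The value on a path. -/
  toFun : ∀ {a b : X}, Path a b → G
  map_trans : ∀ {a b c : X} (p : Path a b) (q : Path b c),
    toFun (p.trans q) = toFun p * toFun q
  map_homotopic : ∀ {a b : X} {p q : Path a b}, p.Homotopic q → toFun p = toFun q

namespace PathHom

variable {X G : Type*} [TopologicalSpace X] [Group G]

lemma map_refl (Φ : PathHom X G) (a : X) : Φ.toFun (Path.refl a) = 1 := by
  have h := Φ.map_trans (Path.refl a) (Path.refl a)
  rw [Path.refl_trans_refl] at h
  simpa using h

lemma map_symm (Φ : PathHom X G) {a b : X} (p : Path a b) :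
    Φ.toFun p.symm = (Φ.toFun p)⁻¹ := by
  refine eq_inv_of_mul_eq_one_right ?_
  rw [← Φ.map_trans, ← Φ.map_homotopic ⟨Path.Homotopy.reflTransSymm p⟩, Φ.map_refl]

/-- The class of a loop, in the opposite of the fundamental group; there, multiplication is
concatenation in the order of travel. -/
def loopClass {x : X} (γ : Path x x) : (FundamentalGroup X x)ᵐᵒᵖ :=
  MulOpposite.op (FundamentalGroup.fromPath (Path.Homotopic.Quotient.mk γ))

lemma loopClass_trans {x : X} (γ γ' : Path x x) :
    loopClass (γ.trans γ') = loopClass γ * loopClass γ' := rfl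

lemma loopClass_eq_iff {x : X} {γ γ' : Path x x} :
    loopClass γ = loopClass γ' ↔ γ.Homotopic γ' := by
  rw [loopClass, loopClass, MulOpposite.op_inj]
  exact Path.Homotopic.Quotient.eq

lemma loopClass_surjective (x : X) : Function.Surjective (loopClass (x := x)) := fun g => by
  obtain ⟨γ, hγ⟩ := Path.Homotopic.Quotient.mk_surjective (FundamentalGroup.toPath g.unop)
  exact ⟨γ, MulOpposite.unop_injective hγ⟩

/-- Restriction of a path homomorphism to the loops at a point. -/
def toMonoidHom (Φ : PathHom X G) (x : X) : (FundamentalGroup X x)ᵐᵒᵖ →* G :=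
  MonoidHom.mk' (fun g => Quotient.lift (fun γ : Path x x => Φ.toFun γ)
    (fun _ _ h => Φ.map_homotopic h) (FundamentalGroup.toPath g.unop)) (fun g h => by
      obtain ⟨γ, rfl⟩ := loopClass_surjective x g
      obtain ⟨γ', rfl⟩ := loopClass_surjective x h
      exact Φ.map_trans γ γ')

@[simp] lemma toMonoidHom_loopClass (Φ : PathHom X G) {x : X} (γ : Path x x) :
    Φ.toMonoidHom x (loopClass γ) = Φ.toFun γ := rfl

/-- Turning paths into loops at `x` by means of a chosen system `τ` of paths starting at `x`. -/
def based {x : X} (τ : ∀ a, Path x a) : PathHom X (FundamentalGroup X x)ᵐᵒᵖ where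
  toFun {a b} p := loopClass ((τ a).trans (p.trans (τ b).symm))
  map_trans {a b c} p q := by
    rw [← loopClass_trans, loopClass_eq_iff]
    refine Path.Homotopic.Quotient.exact ?_
    simp only [Path.Homotopic.Quotient.mk_trans, Path.Homotopic.Quotient.mk_symm,
      Path.Homotopic.Quotient.trans_assoc]
    rw [← Path.Homotopic.Quotient.trans_assoc (Path.Homotopic.Quotient.mk (τ b)).symm]
    simp
  map_homotopic h :=
    loopClass_eq_iff.2 ((Path.Homotopic.refl _).hcomp (h.hcomp (Path.Homotopic.refl _)))

lemma toMonoidHom_based (Φ : PathHom X G) {x : X} (τ : ∀ a, Path x a) {a b : X} (p : Path a b) :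
    Φ.toMonoidHom x ((based τ).toFun p) = Φ.toFun (τ a) * Φ.toFun p * (Φ.toFun (τ b))⁻¹ := by
  simp only [based, toMonoidHom_loopClass, Φ.map_trans, Φ.map_symm, mul_assoc]

lemma based_loop {x : X} (τ : ∀ a, Path x a) (γ : Path x x) :
    (based τ).toFun γ = loopClass (τ x) * loopClass γ * (loopClass (τ x))⁻¹ := by
  have h : loopClass (τ x).symm = (loopClass (τ x))⁻¹ := rfl
  simp only [based, loopClass_trans, h, mul_assoc]

end PathHom

/-! ### Subdividing paths -/

/-- The `i`-th point of the subdivision of the unit interval into `N` equal parts. -/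
def gridPt (N i : ℕ) : unitInterval := Set.projIcc 0 1 zero_le_one ((i : ℝ) / N)

lemma gridPt_zero (N : ℕ) : gridPt N 0 = 0 := by
  simp [gridPt]

lemma gridPt_of_le {N i : ℕ} (hN : 0 < N) (h : N ≤ i) : gridPt N i = 1 := by
  have : (1 : ℝ) ≤ (i : ℝ) / N := by
    rw [le_div_iff₀ (by positivity)]
    simpa using h
  exact Set.projIcc_of_right_le _ this

lemma coe_gridPt {N i : ℕ} (h : i ≤ N) : (gridPt N i : ℝ) = (i : ℝ) / N := by
  have : (i : ℝ) / N ≤ 1 := div_le_one_of_le₀ (by exact_mod_cast h) (by positivity)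
  rw [gridPt, Set.projIcc_of_mem zero_le_one ⟨by positivity, this⟩]

lemma dist_gridPt_le (N i M j : ℕ) :
    dist (gridPt N i) (gridPt M j) ≤ |(i : ℝ) / N - (j : ℝ) / M| := by
  simpa [Real.dist_eq, gridPt] using (LipschitzWith.projIcc (zero_le_one (α := ℝ))).dist_le_mul
    ((i : ℝ) / N) ((j : ℝ) / M)

lemma dist_gridPt_succ_le (N i : ℕ) : dist (gridPt N i) (gridPt N (i + 1)) ≤ 1 / N := by
  refine (dist_gridPt_le _ _ _ _).trans_eq ?_
  rw [← sub_div, abs_div]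
  simp

lemma dist_gridPt_refine_le {N i : ℕ} (hN : 0 < N) (h : i ≤ N + 1) :
    dist (gridPt N i) (gridPt (N + 1) i) ≤ 1 / N := by
  refine (dist_gridPt_le _ _ _ _).trans ?_
  have h0 : (0 : ℝ) < N := by exact_mod_cast hN
  have h1 : (i : ℝ) ≤ N + 1 := by exact_mod_cast h
  have : (i : ℝ) / N - (i : ℝ) / ((N + 1 : ℕ) : ℝ) = (1 / N) * ((i : ℝ) / (N + 1)) := by
    push_cast
    field_simp
    ring
  rw [this, abs_of_nonneg (by positivity)]
  exact mul_le_of_le_one_right (by positivity) (div_le_one_of_le₀ h1 (by positivity))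

/-- Induction over paths: a property stable under concatenation and homotopy holds for a path `p`
as soon as it holds for all paths inside `p` of small diameter. -/
lemma path_induction {X : Type*} [MetricSpace X] {ε : ℝ} (hε : 0 < ε) {a b : X} (p : Path a b)
    (Q : ∀ {u v : X}, Path u v → Prop)
    (htrans : ∀ {u v w : X} (q : Path u v) (r : Path v w), Q q → Q r → Q (q.trans r))
    (hhom : ∀ {u v : X} {q r : Path u v}, q.Homotopic r → Q q → Q r)
    (hsmall : ∀ {u v : X} (q : Path u v), Set.range q ⊆ Set.range p →
      (∀ s t, dist (q s) (q t) < ε) → Q q) : Q p := by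
  obtain ⟨δ, hδ, hp⟩ := Metric.uniformContinuous_iff.1
    (CompactSpace.uniformContinuous_of_continuous p.continuous) ε hε
  obtain ⟨n, hn⟩ := exists_nat_one_div_lt hδ
  have hn' : (1 : ℝ) / ((n + 1 : ℕ) : ℝ) < δ := by exact_mod_cast hn
  have key : ∀ i, Q (p.subpath 0 (gridPt (n + 1) i)) := by
    intro i
    induction i with
    | zero =>
      rw [gridPt_zero, Path.subpath_self]
      refine hsmall _ ?_ (by simpa using hε)
      rintro _ ⟨s, rfl⟩
      exact ⟨0, rfl⟩
    | succ i ih =>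
      refine hhom ⟨Path.Homotopy.subpathTransSubpath p 0 (gridPt (n + 1) i) _⟩ (htrans _ _ ih ?_)
      refine hsmall _ ?_ fun s t => hp ?_
      · rw [Path.range_subpath]
        exact Set.image_subset_range _ _
      · have h1 : ∀ s, Set.Icc.convexComb (gridPt (n + 1) i) (gridPt (n + 1) (i + 1)) s ∈
            Set.uIcc (gridPt (n + 1) i) (gridPt (n + 1) (i + 1)) := fun s => by
          rw [← Path.range_subpathAux]
          exact ⟨s, rfl⟩
        refine lt_of_le_of_lt ?_ ((dist_gridPt_succ_le (n + 1) i).trans_lt hn')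
        have hcoe : ∀ {x y z : unitInterval}, z ∈ Set.uIcc x y →
            (z : ℝ) ∈ Set.uIcc (x : ℝ) y := fun {x y z} hz => by
          simpa only [Set.mem_uIcc, Subtype.coe_le_coe] using hz
        rw [Subtype.dist_eq, Subtype.dist_eq]
        exact Real.dist_le_of_mem_uIcc (hcoe (h1 s)) (hcoe (h1 t))
  have h1 : Q (p.subpath 0 1) := by
    have := key (n + 1)
    rwa [gridPt_of_le n.succ_pos le_rfl] at this
  rw [Path.subpath_zero_one] at h1
  have h2 : ∀ (u v : X) (hu : u = a) (hv : v = b), Q (p.cast hu hv) → Q p := by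
    rintro _ _ rfl rfl h
    exact h
  exact h2 _ _ p.source p.target h1

/-! ### Integrating local cocycles -/

/-- A group-valued function of pairs of points satisfying the cocycle identity on triples of
points at mutual distance `< ε`. -/
def IsLocalCocycle {X G : Type*} [MetricSpace X] [Group G] (ε : ℝ) (c : X → X → G) : Prop :=
  ∀ u v w : X, dist u v < ε → dist v w < ε → dist u w < ε → c u v * c v w = c u w

/-- The product of the values of `c` along the first `n` steps of a sequence of points. -/
def chainProd {X G : Type*} [Group G] (c : X → X → G) (f : ℕ → X) : ℕ → G
  | 0 => 1
  | n + 1 => chainProd c f n * c (f n) (f (n + 1))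

section chainProd

variable {X G : Type*} [Group G] (c : X → X → G)

lemma chainProd_congr {f g : ℕ → X} {n : ℕ} (h : ∀ i ≤ n, f i = g i) :
    chainProd c f n = chainProd c g n := by
  induction n with
  | zero => rfl
  | succ n ih =>
    rw [chainProd, chainProd, ih fun i hi => h i (by omega), h n (by omega), h (n + 1) le_rfl]

lemma chainProd_add (f : ℕ → X) (m n : ℕ) :
    chainProd c f (m + n) = chainProd c f m * chainProd c (fun i => f (m + i)) n := by
  induction n with
  | zero => simp [chainProd]
  | succ n ih => rw [← add_assoc, chainProd, ih, chainProd, mul_assoc]; rfl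

end chainProd

namespace IsLocalCocycle

variable {X G : Type*} [MetricSpace X] [Group G] {ε : ℝ} {c : X → X → G}

lemma self (hc : IsLocalCocycle ε c) (hε : 0 < ε) (a : X) : c a a = 1 := by
  have := hc a a a (by simpa) (by simpa) (by simpa)
  simpa using this

lemma chainProd_mul (hc : IsLocalCocycle ε c) {f g : ℕ → X} {n : ℕ}
    (hf : ∀ i < n, dist (f i) (f (i + 1)) < ε) (hg : ∀ i < n, dist (g i) (g (i + 1)) < ε)
    (hfg : ∀ i ≤ n, dist (f i) (g i) < ε) (hfg' : ∀ i < n, dist (f i) (g (i + 1)) < ε) :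
    chainProd c f n * c (f n) (g n) = c (f 0) (g 0) * chainProd c g n := by
  induction n with
  | zero => simp [chainProd]
  | succ n ih =>
    have ih := ih (fun i hi => hf i (by omega)) (fun i hi => hg i (by omega))
      (fun i hi => hfg i (by omega)) (fun i hi => hfg' i (by omega))
    have h1 := hc (f n) (f (n + 1)) (g (n + 1)) (hf n (by omega)) (hfg _ le_rfl)
      (hfg' n (by omega))
    have h2 := hc (f n) (g n) (g (n + 1)) (hfg n (by omega)) (hg n (by omega))
      (hfg' n (by omega))
    rw [chainProd, chainProd, mul_assoc, h1, ← h2, ← mul_assoc, ih, mul_assoc]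

/-- Product of `c` along the subdivision of a path into `N` parts. -/
def gridProd (c : X → X → G) {a b : X} (p : Path a b) (N : ℕ) : G :=
  chainProd c (fun i => p (gridPt N i)) N

lemma exists_gridProd_eventually_eq (hc : IsLocalCocycle ε c) (hε : 0 < ε) {a b : X}
    (p : Path a b) : ∃ g, ∀ᶠ N in Filter.atTop, gridProd c p N = g := by
  obtain ⟨δ, hδ, hp⟩ := Metric.uniformContinuous_iff.1
    (CompactSpace.uniformContinuous_of_continuous p.continuous) ε hε
  obtain ⟨n, hn⟩ := exists_nat_one_div_lt (half_pos hδ)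
  have hN : ∀ N ≥ n + 1, (1 : ℝ) / N < δ / 2 := fun N hN =>
    (one_div_le_one_div_of_le (by positivity) (by exact_mod_cast hN)).trans_lt hn
  have step : ∀ N ≥ n + 1, gridProd c p (N + 1) = gridProd c p N := by
    intro N hN'
    have hNδ := hN N hN'
    have hNδ' := hN (N + 1) (by omega)
    have h := hc.chainProd_mul (f := fun i => p (gridPt N i))
      (g := fun i => p (gridPt (N + 1) i)) (n := N + 1)
      (fun i _ => hp ((dist_gridPt_succ_le N i).trans_lt (by linarith)))
      (fun i _ => hp ((dist_gridPt_succ_le (N + 1) i).trans_lt (by linarith)))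
      (fun i hi => hp ((dist_gridPt_refine_le (by omega) hi).trans_lt (by linarith)))
      (fun i hi => hp (by
        have h1 := dist_triangle (gridPt N i) (gridPt (N + 1) i) (gridPt (N + 1) (i + 1))
        have h2 := dist_gridPt_refine_le (by omega) hi.le
        have h3 := dist_gridPt_succ_le (N + 1) i
        linarith))
    simp only [gridPt_zero, gridPt_of_le N.succ_pos le_rfl,
      gridPt_of_le (show 0 < N by omega) (Nat.le_succ N), hc.self hε, mul_one, one_mul] at h
    rw [gridProd, ← h, chainProd, gridPt_of_le (show 0 < N by omega) le_rfl,
      gridPt_of_le (show 0 < N by omega) (Nat.le_succ N), hc.self hε, mul_one, gridProd]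
  refine ⟨gridProd c p (n + 1), Filter.eventually_atTop.2 ⟨n + 1, fun N hN' => ?_⟩⟩
  induction N, hN' using Nat.le_induction with
  | base => rfl
  | succ N hN' ih => rw [step N hN', ih]

lemma gridProd_trans (c : X → X → G) {u v w : X} (p : Path u v) (q : Path v w) {N : ℕ}
    (hN : 0 < N) : gridProd c (p.trans q) (N + N) = gridProd c p N * gridProd c q N := by
  have hN' : (0 : ℝ) < N := by exact_mod_cast hN
  rw [gridProd, chainProd_add]
  congr 1
  · refine chainProd_congr c fun i hi => ?_
    have hi' : (i : ℝ) ≤ N := by exact_mod_cast hi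
    have h : (gridPt (N + N) i : ℝ) = i / (N + N) := by
      rw [coe_gridPt (by omega)]; push_cast; rfl
    rw [Path.trans_apply, dif_pos]
    · congr 1
      ext
      change 2 * (gridPt (N + N) i : ℝ) = gridPt N i
      rw [coe_gridPt hi, h]
      field_simp
      ring
    · rw [h, div_le_div_iff₀ (by positivity) (by positivity)]
      linarith
  · refine chainProd_congr c fun i hi => ?_
    have hi' : (i : ℝ) ≤ N := by exact_mod_cast hi
    have h : (gridPt (N + N) (N + i) : ℝ) = (N + i) / (N + N) := by
      rw [coe_gridPt (by omega)]; push_cast; rfl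
    rw [Path.trans_apply]
    split_ifs with h0
    · rw [h, div_le_div_iff₀ (by positivity) (by positivity)] at h0
      have : i = 0 := by
        have : (i : ℝ) ≤ 0 := by linarith
        exact_mod_cast le_antisymm this (by positivity)
      subst this
      rw [gridPt_zero, q.source]
      convert p.target
      rw [h]
      field_simp
      simp
      ring
    · congr 1
      ext
      change 2 * (gridPt (N + N) (N + i) : ℝ) - 1 = gridPt N i
      rw [coe_gridPt hi, h]
      field_simp
      ring

lemma gridProd_homotopic (hc : IsLocalCocycle ε c) (hε : 0 < ε) {a b : X} {p q : Path a b}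
    (h : p.Homotopic q) : ∀ᶠ N in Filter.atTop, gridProd c p N = gridProd c q N := by
  obtain ⟨H⟩ := h
  obtain ⟨δ, hδ, hp⟩ := Metric.uniformContinuous_iff.1
    (CompactSpace.uniformContinuous_of_continuous H.continuous) ε hε
  obtain ⟨n, hn⟩ := exists_nat_one_div_lt hδ
  refine Filter.eventually_atTop.2 ⟨n + 1, fun N hN' => ?_⟩
  have hN : (1 : ℝ) / N < δ :=
    (one_div_le_one_div_of_le (by positivity) (by exact_mod_cast hN')).trans_lt hn
  have hN0 : 0 < N := by omega
  have hclose : ∀ i j, dist (gridPt N i) (gridPt N (i + 1)) < δ ∧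
      dist (gridPt N j) (gridPt N j) < δ :=
    fun i j => ⟨(dist_gridPt_succ_le N i).trans_lt hN, by simpa⟩
  have key : ∀ j, gridProd c p N = chainProd c (fun i => H (gridPt N j, gridPt N i)) N := by
    intro j
    induction j with
    | zero => simp [gridPt_zero, gridProd]
    | succ j ih =>
      have := hc.chainProd_mul (f := fun i => H (gridPt N j, gridPt N i))
        (g := fun i => H (gridPt N (j + 1), gridPt N i)) (n := N)
        (fun i _ => hp (max_lt (hclose i j).2 (hclose i j).1))
        (fun i _ => hp (max_lt (hclose i (j + 1)).2 (hclose i j).1))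
        (fun i _ => hp (max_lt (hclose j j).1 (hclose i i).2))
        (fun i _ => hp (max_lt (hclose j j).1 (hclose i i).1))
      simp only [gridPt_zero, gridPt_of_le hN0 le_rfl, H.source, H.target, hc.self hε, mul_one,
        one_mul] at this
      rw [ih, this]
  rw [key N, gridPt_of_le hN0 le_rfl]
  simp [gridProd]

/-- A local cocycle extends to a homotopy-invariant multiplicative function on paths. -/
lemma exists_pathHom (hc : IsLocalCocycle ε c) (hε : 0 < ε) :
    ∃ Φ : PathHom X G, ∀ {a b : X} (p : Path a b), (∀ s t, dist (p s) (p t) < ε) →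
      Φ.toFun p = c a b := by
  choose g hg using fun (a b : X) (p : Path a b) => hc.exists_gridProd_eventually_eq hε p
  refine ⟨⟨fun {a b} p => g a b p, fun {u v w} p q => ?_, fun {u v p q} h => ?_⟩,
    fun {a b} p hp => ?_⟩
  · have htwo : Filter.Tendsto (fun N : ℕ => N + N) Filter.atTop Filter.atTop :=
      Filter.tendsto_atTop_mono (fun N => Nat.le_add_left N N) Filter.tendsto_id
    obtain ⟨N, h1, h2, h3, h4⟩ := ((htwo.eventually (hg u w (p.trans q))).and
      ((hg u v p).and ((hg v w q).and (Filter.eventually_gt_atTop 0)))).exists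
    rw [← h1, ← h2, ← h3, gridProd_trans c p q h4]
  · obtain ⟨N, h1, h2, h3⟩ := ((hg u v p).and ((hg u v q).and
      (hc.gridProd_homotopic hε h))).exists
    rw [← h1, ← h2, h3]
  · obtain ⟨N, h1, h2⟩ := ((hg a b p).and (Filter.eventually_gt_atTop 0)).exists
    have key : ∀ n, chainProd c (fun i => p (gridPt N i)) n = c a (p (gridPt N n)) := by
      intro n
      induction n with
      | zero => simp [chainProd, gridPt_zero, hc.self hε]
      | succ n ih =>
        rw [chainProd, ih]
        have hd : ∀ t, dist a (p t) < ε := fun t => by simpa using hp 0 t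
        exact hc _ _ _ (hd _) (hp _ _) (hd _)
    change g a b p = _
    rw [← h1, gridProd, key, gridPt_of_le h2 le_rfl, p.target]

end IsLocalCocycle

/-! ### Short loops and short paths -/

lemma homotopic_refl_of_isNullLoop {X : Type*} [TopologicalSpace X] {a : X} (γ : Path a a)
    (h : IsNullLoop (γ : C(unitInterval, X))) : γ.Homotopic (Path.refl a) := by
  obtain ⟨y, H, h0, h1, hs⟩ := h
  have h00 : a = H (0, 0) := by simpa using (h0 0).symm
  have h01 : a = H (0, 1) := by simpa using (h0 1).symm
  have : ContractibleSpace unitInterval :=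
    (convex_Icc (0 : ℝ) 1).contractibleSpace ⟨0, by simp⟩
  let ι : Path (0 : unitInterval) 1 := ⟨ContinuousMap.id _, rfl, rfl⟩
  let δ : Path a y := ⟨⟨fun s => H (s, 0), by fun_prop⟩, h00.symm, by simpa using h1 0⟩
  have key := ((SimplyConnectedSpace.paths_homotopic ((Path.refl 0).prod ι)
    ((ι.prod (Path.refl 0)).trans (((Path.refl 1).prod ι).trans
      (ι.symm.prod (Path.refl 1))))).map H).pathCast h00 h01
  have e1 : (((Path.refl 0).prod ι).map H.continuous).cast h00 h01 = γ := by
    ext t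
    exact h0 t
  have e2 : ((((ι.prod (Path.refl 0)).trans (((Path.refl 1).prod ι).trans
      (ι.symm.prod (Path.refl 1)))).map H.continuous).cast h00 h01) =
      δ.trans ((Path.refl y).trans δ.symm) := by
    ext t
    simp only [Path.cast_coe, Path.map_coe, Function.comp_apply, Path.trans_apply]
    split_ifs
    · rfl
    · exact h1 _
    · exact (hs _).symm
  rw [e1, e2] at key
  exact key.trans (((Path.Homotopic.refl δ).hcomp ⟨Path.Homotopy.reflTrans δ.symm⟩).trans
    ⟨(Path.Homotopy.reflTransSymm δ).symm⟩)

/-- A path which, between any two of its points, wastes no more than the length `L`; every path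
of length at most `L` has this property. -/
def IsShort {X : Type*} [MetricSpace X] {a b : X} (L : ℝ) (p : Path a b) : Prop :=
  ∀ s t : unitInterval, s ≤ t → dist a (p s) + dist (p s) (p t) + dist (p t) b ≤ L

lemma IsShort.dist_left_le {X : Type*} [MetricSpace X] {a b : X} {L : ℝ} {p : Path a b}
    (hp : IsShort L p) (t : unitInterval) : dist a (p t) + dist (p t) b ≤ L := by
  simpa using hp t t le_rfl

lemma IsLengthSpace.exists_isShort {X : Type*} [MetricSpace X] (hX : IsLengthSpace X) {a b : X}
    {L : ℝ} (hL : dist a b < L) : ∃ p : Path a b, IsShort L p := by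
  have hL0 : 0 < L := dist_nonneg.trans_lt hL
  have h : ENNReal.ofReal (dist a b) < ENNReal.ofReal L := (ENNReal.ofReal_lt_ofReal_iff hL0).2 hL
  rw [hX a b] at h
  simp only [iInf_lt_iff] at h
  obtain ⟨γ, ⟨hc, h0, h1⟩, hγ⟩ := h
  refine ⟨⟨⟨fun t => γ t, hc.comp_continuous continuous_subtype_val fun t => t.2⟩,
    by simpa using h0, by simpa using h1⟩, fun s t hst => ?_⟩
  have hst' : (s : ℝ) ≤ t := hst
  have e1 := eVariationOn.Icc_add_Icc γ (s := Set.univ) s.2.1 s.2.2 (Set.mem_univ _)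
  have e2 := eVariationOn.Icc_add_Icc γ (s := Set.univ) hst' t.2.2 (Set.mem_univ _)
  simp only [Set.univ_inter] at e1 e2
  have d1 := eVariationOn.edist_le γ (s := Set.Icc 0 (s : ℝ)) (x := 0) (y := s)
    ⟨le_rfl, s.2.1⟩ ⟨s.2.1, le_rfl⟩
  have d2 := eVariationOn.edist_le γ (s := Set.Icc (s : ℝ) t) (x := s) (y := t)
    ⟨le_rfl, hst'⟩ ⟨hst', le_rfl⟩
  have d3 := eVariationOn.edist_le γ (s := Set.Icc (t : ℝ) 1) (x := t) (y := 1)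
    ⟨le_rfl, t.2.2⟩ ⟨t.2.2, le_rfl⟩
  have hsum : edist (γ 0) (γ s) + edist (γ s) (γ t) + edist (γ t) (γ 1) ≤ ENNReal.ofReal L := by
    refine le_trans ?_ hγ.le
    rw [← e1, ← e2, add_assoc]
    gcongr
  simp only [edist_dist] at hsum
  rw [← ENNReal.ofReal_add dist_nonneg dist_nonneg,
    ← ENNReal.ofReal_add (by positivity) dist_nonneg, ENNReal.ofReal_le_ofReal_iff hL0.le] at hsum
  rwa [h0, h1] at hsum

lemma IsLengthSpace.exists_dist_le_half {X : Type*} [MetricSpace X] (hX : IsLengthSpace X)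
    (a b : X) {η : ℝ} (hη : 0 < η) :
    ∃ w : X, dist a w ≤ dist a b / 2 + η ∧ dist w b ≤ dist a b / 2 + η := by
  obtain ⟨p, hp⟩ := hX.exists_isShort (lt_add_of_pos_right (dist a b) hη)
  obtain ⟨t, ht⟩ := intermediate_value_univ (0 : unitInterval) 1
    (f := fun t => dist a (p t)) (by fun_prop)
    (show dist a b / 2 ∈ Set.Icc _ _ by
      have := dist_nonneg (x := a) (y := b)
      rw [Set.mem_Icc, p.source, p.target, dist_self]
      constructor <;> linarith)
  have := hp.dist_left_le t
  dsimp only at ht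
  exact ⟨p t, by linarith, by linarith⟩

/-- Every loop all of whose points are at mutual distance at most `K` is contractible. -/
def LoopsContractible (X : Type*) [MetricSpace X] (K : ℝ) : Prop :=
  ∀ (a : X) (γ : Path a a), (∀ s t, dist (γ s) (γ t) ≤ K) → γ.Homotopic (Path.refl a)

namespace LoopsContractible

variable {X : Type*} [MetricSpace X] {K : ℝ}

lemma of_isNullLoop {K' : ℝ} (hK : 0 ≤ K) (hKK : K < K')
    (h : ∀ γ : C(unitInterval, X), IsLoop γ → Metric.diam (Set.range γ) < K' → IsNullLoop γ) :
    LoopsContractible X K := fun a γ hγ => by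
  refine homotopic_refl_of_isNullLoop γ (h _ ?_ (lt_of_le_of_lt ?_ hKK))
  · simp [IsLoop]
  · refine Metric.diam_le_of_forall_dist_le hK ?_
    rintro _ ⟨s, rfl⟩ _ ⟨t, rfl⟩
    exact hγ s t

lemma homotopic (h : LoopsContractible X K) {a b : X} (p q : Path a b)
    (hp : ∀ s t, dist (p s) (p t) ≤ K) (hq : ∀ s t, dist (q s) (q t) ≤ K)
    (hpq : ∀ s t, dist (p s) (q t) ≤ K) : p.Homotopic q := by
  have hloop : (p.trans q.symm).Homotopic (Path.refl a) := h a _ fun s t => by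
    simp only [Path.trans_apply]
    split_ifs
    · exact hp _ _
    · exact hpq _ _
    · rw [dist_comm]; exact hpq _ _
    · exact hq _ _
  refine Path.Homotopic.Quotient.exact ?_
  have := Path.Homotopic.Quotient.eq.2 hloop
  simp only [Path.Homotopic.Quotient.mk_trans, Path.Homotopic.Quotient.mk_symm,
    Path.Homotopic.Quotient.mk_refl] at this
  have h2 := congrArg (fun x => x.trans (Path.Homotopic.Quotient.mk q)) this
  simpa using h2

/-- Triangles of perimeter at most `2K` are contractible. -/
lemma trans_homotopic (h : LoopsContractible X K) {a b c : X} {p : Path a b} {q : Path b c}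
    {r : Path a c} {L₁ L₂ L₃ : ℝ} (hp : IsShort L₁ p) (hq : IsShort L₂ q) (hr : IsShort L₃ r)
    (hL : L₁ + L₂ + L₃ ≤ 2 * K) : (p.trans q).Homotopic r := by
  have side : ∀ {x y z : X} {L : ℝ} (f : Path x y), IsShort L f → ∀ L',
      dist x z + dist z y ≤ L' → L + L' ≤ 2 * K → ∀ s t, dist (f s) (f t) ≤ K := by
    intro x y z L f hf L' hL' hLK s t
    wlog hst : s ≤ t generalizing s t
    · rw [dist_comm]; exact this t s (le_of_not_ge hst)
    have h1 := hf s t hst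
    have h2 := dist_triangle4 (f s) x y (f t)
    have h3 := dist_triangle x z y
    rw [dist_comm (f s) x, dist_comm y] at h2
    linarith
  have corner : ∀ {x y z : X} {L L' : ℝ} (f : Path x y) (g : Path y z), IsShort L f →
      IsShort L' g → L + L' + dist x z ≤ 2 * K → ∀ s t, dist (f s) (g t) ≤ K := by
    intro x y z L L' f g hf hg hLK s t
    have h1 := hf.dist_left_le s
    have h2 := hg.dist_left_le t
    have h3 := dist_triangle (f s) y (g t)
    have h4 := dist_triangle4 (f s) x z (g t)
    rw [dist_comm (f s) x, dist_comm z] at h4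
    linarith
  have symm_short : ∀ {x y : X} {L : ℝ} (f : Path x y), IsShort L f → IsShort L f.symm := by
    intro x y L f hf s t hst
    have := hf (unitInterval.symm t) (unitInterval.symm s) (unitInterval.symm_le_symm.2 hst)
    simp only [Path.symm_apply, Function.comp_apply]
    linarith [dist_comm y (f (unitInterval.symm s)), dist_comm x (f (unitInterval.symm t)),
      dist_comm (f (unitInterval.symm s)) (f (unitInterval.symm t))]
  have dp : dist a b ≤ L₁ := by simpa using hp.dist_left_le 0
  have dq : dist b c ≤ L₂ := by simpa using hq.dist_left_le 0
  have dr : dist a c ≤ L₃ := by simpa using hr.dist_left_le 0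
  have dcb := dist_comm c b
  have dba := dist_comm b a
  have pp := side (z := c) p hp (L₃ + L₂) (by linarith) (by linarith)
  have qq := side (z := a) q hq (L₁ + L₃) (by linarith) (by linarith)
  have rr := side (z := b) r hr (L₁ + L₂) (by linarith) (by linarith)
  have pq := corner p q hp hq (by linarith)
  have rp := corner r.symm p (symm_short r hr) hp (by linarith)
  have qr := corner q r.symm hq (symm_short r hr) (by linarith)
  have pr : ∀ s t, dist (p s) (r t) ≤ K := fun s t => by
    simpa [dist_comm] using rp (unitInterval.symm t) s
  have qr : ∀ s t, dist (q s) (r t) ≤ K := fun s t => by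
    simpa using qr s (unitInterval.symm t)
  refine h.homotopic _ _ (fun s t => ?_) rr (fun s t => ?_)
  · simp only [Path.trans_apply]
    split_ifs
    · exact pp _ _
    · exact pq _ _
    · rw [dist_comm]; exact pq _ _
    · exact qq _ _
  · simp only [Path.trans_apply]
    split_ifs
    · exact pr _ _
    · exact qr _ _

end LoopsContractible

/-- The data obtained by assigning group elements to pairs of nearby points via a short path
between them: `e u v` is the value of `Θ` on a path of length less than `dist u v + η`, and `e` is
multiplicative on triangles of perimeter at most `2K - 3η`. -/
structure IsEdgeSystem {X G : Type*} [MetricSpace X] [Group G] (Θ : PathHom X G) (K η : ℝ)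
    (e : X → X → G) : Prop where
  exists_path : ∀ u v, ∃ q : Path u v, (∀ t, dist u (q t) ≤ dist u v + η) ∧ Θ.toFun q = e u v
  mul : ∀ u v w, dist u v + dist v w + dist u w + 3 * η ≤ 2 * K → e u v * e v w = e u w
  of_small : ∀ {u v} (p : Path u v), (∀ s t, dist (p s) (p t) < η) → Θ.toFun p = e u v

lemma exists_isEdgeSystem {X G : Type*} [MetricSpace X] [Group G] (hX : IsLengthSpace X)
    {K η : ℝ} (hη : 0 < η) (hK : 4 * η ≤ K) (h : LoopsContractible X K) (Θ : PathHom X G) :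
    ∃ e, IsEdgeSystem Θ K η e := by
  choose q hq using fun a b : X => hX.exists_isShort (lt_add_of_pos_right (dist a b) hη)
  refine ⟨fun a b => Θ.toFun (q a b), fun u v => ⟨q u v, fun t => ?_, rfl⟩, fun u v w hd => ?_,
    fun {u v} p hp => ?_⟩
  · have := (hq u v).dist_left_le t
    have := dist_nonneg (x := q u v t) (y := v)
    linarith
  · rw [← Θ.map_trans]
    exact Θ.map_homotopic (h.trans_homotopic (hq u v) (hq v w) (hq u w) (by linarith))
  · have huv : dist u v < η := by simpa using hp 0 1
    have hq' : ∀ t, dist u (q u v t) ≤ 2 * η := fun t => by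
      have := (hq u v).dist_left_le t
      have := dist_nonneg (x := q u v t) (y := v)
      linarith
    refine Θ.map_homotopic (h.homotopic _ _ (fun s t => by linarith [hp s t]) (fun s t => ?_)
      fun s t => ?_)
    · have := dist_triangle_left (q u v s) (q u v t) u
      linarith [hq' s, hq' t]
    · have := dist_triangle_left (p s) (q u v t) u
      have := hp 0 s
      rw [p.source] at this
      linarith [hq' t]

/-! ### Comparing two spaces -/

section comparison

variable {X Y GX GY : Type*} [MetricSpace X] [MetricSpace Y] [Group GX] [Group GY]
  {Θ : PathHom X GX} {Θ' : PathHom Y GY} {D η : ℝ}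
  {e : X → X → GX} {e' : Y → Y → GY} {f : X → Y} {g : Y → X}

/-- If `f` increases distances by at most `2D`, an edge system pulls back to a cocycle. -/
lemma IsEdgeSystem.isLocalCocycle (he : IsEdgeSystem Θ' (4 * (D + 2 * η)) η e') (hD : 0 ≤ D)
    (hη : 0 < η) (hf : ∀ a b, dist (f a) (f b) ≤ dist a b + 2 * D) :
    IsLocalCocycle η fun a b => e' (f a) (f b) := fun u v w h1 h2 h3 =>
  he.mul _ _ _ (by linarith [hf u v, hf v w, hf u w])

/-- Along a path `q` within about `D` of `f a`, the transported edge
system has the value predicted by the values of `e` at `a`. -/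
lemma IsEdgeSystem.mul_transport (he : IsEdgeSystem Θ (4 * (D + 2 * η)) η e) (hη : 0 < η)
    (hg : ∀ u v, dist (g u) (g v) ≤ dist u v + 2 * D)
    (hfg : ∀ a u, dist a (g u) ≤ dist (f a) u + 2 * D)
    {Ψ : PathHom Y GX} (hΨ : ∀ {u v : Y} (q : Path u v), (∀ s t, dist (q s) (q t) < η) →
      Ψ.toFun q = e (g u) (g v)) (a : X) {u v : Y} (q : Path u v)
    (hq : ∀ t, dist (f a) (q t) ≤ D + 5 / 2 * η) :
    e a (g u) * Ψ.toFun q = e a (g v) := by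
  refine path_induction hη q (fun {u v} r => e a (g u) * Ψ.toFun r = e a (g v)) ?_ ?_ ?_
  · intro u v w r r' h1 h2
    rw [Ψ.map_trans, ← mul_assoc, h1, h2]
  · intro u v r r' h h1
    rw [← Ψ.map_homotopic h, h1]
  · intro u v r hr hsmall
    have hr' : ∀ t, dist (f a) (r t) ≤ D + 5 / 2 * η := fun t => by
      obtain ⟨s, hs⟩ := hr ⟨t, rfl⟩
      rw [← hs]
      exact hq s
    have hu := hr' 0
    have hv := hr' 1
    have huv := hsmall 0 1
    rw [r.source] at hu huv
    rw [r.target] at hv huv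
    rw [hΨ r hsmall]
    exact he.mul _ _ _ (by linarith [hfg a u, hfg a v, hg u v])

/-- Transporting a path from `X` to `Y` and back conjugates it by a system of group elements. -/
lemma exists_conj (hY : IsLengthSpace Y) {y : Y} {τ : ∀ v, Path y v}
    {e' : Y → Y → (FundamentalGroup Y y)ᵐᵒᵖ} (hD : 0 ≤ D) (hη : 0 < η)
    (he : IsEdgeSystem Θ (4 * (D + 2 * η)) η e)
    (he' : IsEdgeSystem (PathHom.based τ) (4 * (D + 2 * η)) η e')
    (hf : ∀ a b, dist (f a) (f b) ≤ dist a b + 2 * D)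
    (hg : ∀ u v, dist (g u) (g v) ≤ dist u v + 2 * D)
    (hfg : ∀ a u, dist a (g u) ≤ dist (f a) u + 2 * D)
    {Φ : PathHom X (FundamentalGroup Y y)ᵐᵒᵖ}
    (hΦ : ∀ {a b : X} (p : Path a b), (∀ s t, dist (p s) (p t) < η) →
      Φ.toFun p = e' (f a) (f b))
    {Ψ : PathHom Y GX}
    (hΨ : ∀ {u v : Y} (q : Path u v), (∀ s t, dist (q s) (q t) < η) →
      Ψ.toFun q = e (g u) (g v)) :
    ∃ m : X → GX, ∀ {a b : X} (p : Path a b),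
      Ψ.toMonoidHom y (Φ.toFun p) = m a * Θ.toFun p * (m b)⁻¹ := by
  refine ⟨fun a => Ψ.toFun (τ (f a)) * (e a (g (f a)))⁻¹, fun {a b} p => ?_⟩
  refine path_induction hη p (fun {a b} p => Ψ.toMonoidHom y (Φ.toFun p) =
    Ψ.toFun (τ (f a)) * (e a (g (f a)))⁻¹ * Θ.toFun p *
      (Ψ.toFun (τ (f b)) * (e b (g (f b)))⁻¹)⁻¹) ?_ ?_ ?_
  · intro u v w q r h1 h2
    rw [Φ.map_trans, map_mul, h1, h2, Θ.map_trans]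
    group
  · intro u v q r h h1
    rw [← Φ.map_homotopic h, h1, Θ.map_homotopic h]
  · intro a b p _ hp
    have hab : dist a b < η := by simpa using hp 0 1
    obtain ⟨w, haw, hwb⟩ := hY.exists_dist_le_half (f a) (f b) hη
    obtain ⟨q, hq, hqe⟩ := he'.exists_path (f a) w
    obtain ⟨r, hr, hre⟩ := he'.exists_path (f b) w
    have hfab := hf a b
    rw [dist_comm w] at hwb
    have hq' := he.mul_transport hη hg hfg hΨ a q fun t => (hq t).trans (by linarith)
    have hr' := he.mul_transport hη hg hfg hΨ b r fun t => (hr t).trans (by linarith)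
    have h1 : e' (f a) (f b) * e' (f b) w = e' (f a) w := he'.mul _ _ _ (by linarith)
    have h2 : e a b * e b (g w) = e a (g w) := he.mul _ _ _ (by linarith [hfg a w, hfg b w])
    rw [hΦ p hp, he.of_small p hp, eq_mul_inv_of_mul_eq h1, ← hqe, ← hre, map_mul, map_inv,
      Ψ.toMonoidHom_based, Ψ.toMonoidHom_based, eq_mul_inv_of_mul_eq h2, ← hq', ← hr']
    group

end comparison

/-- Spaces related by maps `f` and `g` which are almost isometric and almost inverse to each other
have isomorphic fundamental groups, if their small loops are contractible. -/
lemma nonempty_fundamentalGroup_mulEquiv {X Y : Type*} [MetricSpace X] [MetricSpace Y]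
    (hX : IsLengthSpace X) (hY : IsLengthSpace Y) {D η : ℝ} (hD : 0 ≤ D) (hη : 0 < η)
    (hlX : LoopsContractible X (4 * (D + 2 * η))) (hlY : LoopsContractible Y (4 * (D + 2 * η)))
    {f : X → Y} {g : Y → X}
    (hf : ∀ a b, dist (f a) (f b) ≤ dist a b + 2 * D)
    (hg : ∀ u v, dist (g u) (g v) ≤ dist u v + 2 * D)
    (hfg : ∀ a u, dist a (g u) ≤ dist (f a) u + 2 * D)
    (hgf : ∀ u a, dist u (f a) ≤ dist (g u) a + 2 * D) (x : X) (y : Y) :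
    Nonempty (FundamentalGroup X x ≃* FundamentalGroup Y y) := by
  let ρ : ∀ a, Path x a := fun a => (hX.exists_isShort (lt_add_one (dist x a))).choose
  let τ : ∀ b, Path y b := fun b => (hY.exists_isShort (lt_add_one (dist y b))).choose
  obtain ⟨e, he⟩ := exists_isEdgeSystem hX hη (by linarith) hlX (PathHom.based ρ)
  obtain ⟨e', he'⟩ := exists_isEdgeSystem hY hη (by linarith) hlY (PathHom.based τ)
  obtain ⟨Φ, hΦ⟩ := (he'.isLocalCocycle hD hη hf).exists_pathHom hη
  obtain ⟨Ψ, hΨ⟩ := (he.isLocalCocycle hD hη hg).exists_pathHom hη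
  obtain ⟨m, hm⟩ := exists_conj hY hD hη he he' hf hg hfg hΦ hΨ
  obtain ⟨m', hm'⟩ := exists_conj hX hD hη he' he hg hf hgf hΨ hΦ
  have inj : Function.Injective (Φ.toMonoidHom x) := by
    refine (injective_iff_map_eq_one _).2 fun γ hγ => ?_
    obtain ⟨γ, rfl⟩ := PathHom.loopClass_surjective x γ
    have := hm γ
    rw [← Φ.toMonoidHom_loopClass, hγ, map_one, PathHom.based_loop] at this
    simpa only [conj_eq_one_iff] using this.symm
  have surj : Function.Surjective (Φ.toMonoidHom x) := fun δ => by
    let n := m' y * PathHom.loopClass (τ y)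
    obtain ⟨γ, hγ⟩ := PathHom.loopClass_surjective y (n⁻¹ * δ * n)
    have := hm' γ
    rw [PathHom.based_loop, hγ] at this
    exact ⟨Ψ.toFun γ, this.trans (by simp only [n]; group)⟩
  exact ⟨MulEquiv.op.symm (MulEquiv.ofBijective (Φ.toMonoidHom x) ⟨inj, surj⟩)⟩


/-- **Theorem 2 (main theorem).** If `X` and `Y` are length spaces whose Gromov–Hausdorff
distance is `< D` (i.e. they admit isometric copies in a common metric space at Hausdorff
distance `< D`), and all loops of diameter `< 4D` in `X` and in `Y` are nulhomotopic,
then `π₁(X)` and `π₁(Y)` are isomorphic. -/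
theorem pi1_iso_of_ghDist_lt {X : Type u} {Y : Type v} [MetricSpace X] [MetricSpace Y]
    (hX : IsLengthSpace X) (hY : IsLengthSpace Y) (D : ℝ) (hD : 0 < D)
    (hGH : ∃ (Z : Type (max u v)) (mZ : MetricSpace Z),
      ∃ (fX : X → Z) (fY : Y → Z), Isometry fX ∧ Isometry fY ∧
        EMetric.hausdorffEdist (Set.range fX) (Set.range fY) < ENNReal.ofReal D)
    (hloopX : ∀ γ : C(unitInterval, X), IsLoop γ → Metric.diam (Set.range γ) < 4 * D →
      IsNullLoop γ)
    (hloopY : ∀ γ : C(unitInterval, Y), IsLoop γ → Metric.diam (Set.range γ) < 4 * D →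
      IsNullLoop γ)
    (x₀ : X) (y₀ : Y) :
    Nonempty (FundamentalGroup X x₀ ≃* FundamentalGroup Y y₀) := by
  obtain ⟨Z, mZ, i, j, hi, hj, hij⟩ := hGH
  obtain ⟨r, -, hr, hrD⟩ := ENNReal.lt_iff_exists_real_btwn.1 hij
  have hrD' : r < D := (ENNReal.ofReal_lt_ofReal_iff hD).1 hrD
  have hr0 : 0 < r := ENNReal.ofReal_pos.1 (bot_le.trans_lt hr)
  have hclose : ∀ {p q : Z}, edist p q < ENNReal.ofReal r → dist p q < r := fun h => by
    rwa [edist_dist, ENNReal.ofReal_lt_ofReal_iff hr0] at h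
  have exf : ∀ x, ∃ y, dist (i x) (j y) < r := fun x => by
    obtain ⟨_, ⟨y, rfl⟩, h⟩ :=
      Metric.exists_edist_lt_of_hausdorffEDist_lt (Set.mem_range_self x) hr
    exact ⟨y, hclose h⟩
  have exg : ∀ y, ∃ x, dist (j y) (i x) < r := fun y => by
    obtain ⟨_, ⟨x, rfl⟩, h⟩ :=
      Metric.exists_edist_lt_of_hausdorffEDist_lt (Set.mem_range_self y)
        (Metric.hausdorffEDist_comm.trans_lt hr)
    exact ⟨x, hclose h⟩
  choose f hf using exf
  choose g hg using exg
  have hK : 4 * (r + 2 * ((D - r) / 4)) < 4 * D := by linarith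
  have hK0 : 0 ≤ 4 * (r + 2 * ((D - r) / 4)) := by linarith
  refine nonempty_fundamentalGroup_mulEquiv hX hY hr0.le (η := (D - r) / 4) (by linarith)
    (.of_isNullLoop hK0 hK hloopX) (.of_isNullLoop hK0 hK hloopY) (f := f) (g := g)
    (fun a b => ?_) (fun u v => ?_) (fun a u => ?_) (fun u a => ?_) x₀ y₀
  · rw [← hi.dist_eq, ← hj.dist_eq]
    linarith [dist_triangle4 (j (f a)) (i a) (i b) (j (f b)), hf a, hf b,
      dist_comm (i a) (j (f a))]
  · rw [← hi.dist_eq, ← hj.dist_eq]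
    linarith [dist_triangle4 (i (g u)) (j u) (j v) (i (g v)), hg u, hg v,
      dist_comm (j u) (i (g u))]
  · rw [← hi.dist_eq, ← hj.dist_eq]
    linarith [dist_triangle4 (i a) (j (f a)) (j u) (i (g u)), hf a, hg u]
  · rw [← hi.dist_eq, ← hj.dist_eq]
    linarith [dist_triangle4 (j u) (i (g u)) (i a) (j (f a)), hf a, hg u]

end
end

section
/- Every simply connected length space X satisfies d_GH(X, S¹) ≥ π/4. Equivalently: whenever a simply connected length space X and the circle S¹ (with its intrinsic metric) are isometrically embedded into a common metric space Z, the Hausdorff distance in Z between their images is at least π/4. -/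
open Real Set Metric
open scoped ENNReal unitInterval

noncomputable section

/-- A real number whose absolute value is small compared with the norm of its class modulo `2π`
is the shortest representative of that class. -/
lemma abs_eq_norm_coe_of_lt {v a : ℝ} (hva : ‖(v : IntrinsicCircle)‖ ≤ a)
    (hv : |v| < 2 * π - a) : |v| = ‖(v : IntrinsicCircle)‖ := by
  have hπ := Real.pi_pos
  rw [AddCircle.norm_eq] at hva ⊢
  generalize round ((2 * π)⁻¹ * v) = n at hva ⊢
  obtain rfl : n = 0 := by
    by_contra hn
    have h1 : (1 : ℝ) ≤ |(n : ℝ)| := by exact_mod_cast Int.one_le_abs hn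
    have h2 : |(n : ℝ) * (2 * π)| ≤ |v| + |v - n * (2 * π)| := by
      simpa using abs_sub v (v - n * (2 * π))
    rw [abs_mul, abs_of_pos (by positivity : 0 < 2 * π)] at h2
    nlinarith
  simp

/-- Every point of the circle has a representative realizing its norm. -/
lemma exists_coe_eq_abs_eq_norm (θ : IntrinsicCircle) :
    ∃ v : ℝ, (v : IntrinsicCircle) = θ ∧ |v| = ‖θ‖ := by
  induction θ using QuotientAddGroup.induction_on with
  | H v =>
    refine ⟨v - round ((2 * π)⁻¹ * v) * (2 * π), ?_, (AddCircle.norm_eq _).symm⟩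
    rw [AddCircle.coe_sub, sub_eq_self, AddCircle.coe_eq_zero_iff]
    exact ⟨_, zsmul_eq_mul _ _⟩

lemma cos_pos_iff_norm_coe_lt (v : ℝ) :
    0 < Real.cos v ↔ ‖(v : IntrinsicCircle)‖ < π / 2 := by
  have hle : ‖(v : IntrinsicCircle)‖ ≤ π := by
    have := AddCircle.norm_le_half_period (2 * π) (x := (v : IntrinsicCircle)) (by positivity)
    rw [abs_of_pos (by positivity)] at this
    linarith
  rw [← Real.cos_sub_int_mul_two_pi v (round ((2 * π)⁻¹ * v)), ← Real.cos_abs,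
    ← AddCircle.norm_eq]
  constructor
  · intro h
    by_contra! h'
    linarith [Real.cos_nonpos_of_pi_div_two_le_of_le h' (by linarith [Real.pi_pos])]
  · intro h
    exact Real.cos_pos_of_mem_Ioo ⟨by linarith [norm_nonneg (v : IntrinsicCircle), Real.pi_pos], h⟩

/-- The projection `ℝ → ℝ / 2πℤ` has no section that is locally distance preserving. -/
lemma not_exists_local_isometry_section (τ : IntrinsicCircle → ℝ)
    (hτ : ∀ θ, (τ θ : IntrinsicCircle) = θ) {ε : ℝ} (hε : 0 < ε)
    (hloc : ∀ θ θ', dist θ θ' < ε → |τ θ - τ θ'| = dist θ θ') : False := by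
  have hπ := Real.pi_pos
  have key : ∀ s t : ℝ, τ s - s = τ t - t := by
    refine PreconnectedSpace.induction₂' _ (fun s ↦ ?_) ⟨fun _ _ _ ↦ Eq.trans⟩
    filter_upwards [Metric.ball_mem_nhds s (lt_min hε hπ)] with t ht
    rw [Metric.mem_ball, Real.dist_eq, lt_min_iff] at ht
    have hd : dist (t : IntrinsicCircle) s ≤ |t - s| := by
      rw [dist_eq_norm, ← AddCircle.coe_sub]
      exact QuotientAddGroup.norm_mk_le_norm
    have h1 := hloc t s (hd.trans_lt ht.1)
    have h0 : ‖((τ t - t - (τ s - s) : ℝ) : IntrinsicCircle)‖ = 0 := by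
      simp [hτ]
    have h2 : |τ t - t - (τ s - s)| < 2 * π - 0 := by
      have := abs_sub (τ t - τ s) (t - s)
      rw [show τ t - t - (τ s - s) = τ t - τ s - (t - s) by ring]
      linarith [ht.2]
    have h3 := abs_eq_norm_coe_of_lt h0.le h2
    rw [h0, abs_eq_zero, sub_eq_zero] at h3
    exact ⟨h3.symm, h3⟩
  have h := key (2 * π) 0
  rw [AddCircle.coe_period, AddCircle.coe_zero] at h
  linarith

/-- A nowhere vanishing function on a simply connected, locally path connected space has a
continuous logarithm. -/
lemma exists_continuous_exp_eq {X : Type*} [TopologicalSpace X] [SimplyConnectedSpace X]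
    [LocallyPathConnectedSpace X] (F : C(X, ℂ)) (hF : ∀ x, F x ≠ 0) :
    ∃ G : C(X, ℂ), ∀ x, Complex.exp (G x) = F x := by
  obtain ⟨x₀⟩ : Nonempty X := inferInstance
  obtain ⟨G, ⟨-, hG⟩, -⟩ := Complex.isCoveringMapOn_exp.existsUnique_continuousMap_lifts F
    (Complex.exp_log (hF x₀)) hF
  exact ⟨G, fun x ↦ congr_fun hG x⟩

/-- A map to the circle with small local oscillation on a simply connected, locally path connected
space lifts to a real function with small local oscillation. -/
lemma exists_real_lift {X : Type*} [MetricSpace X] [SimplyConnectedSpace X]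
    [LocallyPathConnectedSpace X] (φ : X → IntrinsicCircle)
    (hφ : ∀ x, ∀ᶠ y in nhds x, dist (φ x) (φ y) < π / 2) :
    ∃ Φ : X → ℝ, (∀ x, (Φ x : IntrinsicCircle) = φ x) ∧
      ∀ x, ∀ᶠ y in nhds x, |Φ x - Φ y| < π / 2 := by
  choose a ha using fun x ↦ QuotientAddGroup.mk_surjective (φ x)
  have ha' : ∀ x, ((a x : ℝ) : IntrinsicCircle) = φ x := ha
  have hre (w : ℂ) (b : ℝ) : (Complex.exp w * Complex.exp (-(b * Complex.I))).re =
      Real.exp w.re * Real.cos (w.im - b) := by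
    rw [← Complex.exp_add, Complex.exp_re]
    simp [sub_eq_add_neg]
  obtain ⟨F, hF⟩ := exists_continuous_forall_mem_convex_of_local_const
    (t := fun x ↦ {z : ℂ | 0 < (z * Complex.exp (-(a x * Complex.I))).re})
    (fun x ↦ convex_halfSpace_gt (f := fun z : ℂ ↦ (z * Complex.exp (-(a x * Complex.I))).re)
      ⟨fun _ _ ↦ by simp [add_mul], fun _ _ ↦ by simp; ring⟩ 0)
    (fun x ↦ ⟨Complex.exp (a x * Complex.I), by
      filter_upwards [hφ x] with y hy
      rw [dist_eq_norm, ← ha', ← ha', ← AddCircle.coe_sub, ← cos_pos_iff_norm_coe_lt] at hy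
      rw [hre]
      simpa using hy⟩)
  obtain ⟨G, hG⟩ := exists_continuous_exp_eq F fun x h0 ↦ by simpa [h0] using hF x
  have hGa (x : X) : ‖(((G x).im : ℝ) : IntrinsicCircle) - φ x‖ < π / 2 := by
    have h := hF x
    rw [Set.mem_ofPred_eq, ← hG, hre] at h
    rw [← ha', ← AddCircle.coe_sub, ← cos_pos_iff_norm_coe_lt]
    exact pos_of_mul_pos_right h (Real.exp_pos _).le
  choose w hw hwn using fun x ↦ exists_coe_eq_abs_eq_norm ((((G x).im : ℝ) : IntrinsicCircle) - φ x)
  have hΦ (x : X) : (((G x).im - w x : ℝ) : IntrinsicCircle) = φ x := by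
    rw [AddCircle.coe_sub, hw]
    abel
  refine ⟨fun x ↦ (G x).im - w x, hΦ, fun x ↦ ?_⟩
  have hcont : Continuous fun y ↦ (G y).im := by fun_prop
  filter_upwards [hφ x, hcont.continuousAt.eventually (Metric.ball_mem_nhds _
    (half_pos Real.pi_pos))] with y hy hG'
  rw [Real.dist_eq, abs_lt] at hG'
  have hx := hGa x
  have hy' := hGa y
  rw [← hwn, abs_lt] at hx hy'
  rw [dist_eq_norm, ← hΦ x, ← hΦ y, ← AddCircle.coe_sub] at hy
  rwa [abs_eq_norm_coe_of_lt hy.le (by rw [abs_lt]; constructor <;> linarith)]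

namespace IsLengthSpace

variable {X : Type*} [MetricSpace X]

lemma exists_path_dist_add_dist_lt (hX : IsLengthSpace X) {x y : X} {L : ℝ}
    (h : dist x y < L) :
    ∃ γ : ℝ → X, ContinuousOn γ (Set.Icc 0 1) ∧ γ 0 = x ∧ γ 1 = y ∧
      ∀ t ∈ Set.Icc (0 : ℝ) 1, dist x (γ t) + dist (γ t) y < L := by
  have hL : ENNReal.ofReal (dist x y) < ENNReal.ofReal L :=
    (ENNReal.ofReal_lt_ofReal_iff (dist_nonneg.trans_lt h)).2 h
  rw [hX x y] at hL
  simp only [iInf_lt_iff] at hL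
  obtain ⟨γ, ⟨hc, h0, h1⟩, hγ⟩ := hL
  refine ⟨γ, hc, h0, h1, fun t ht ↦ ?_⟩
  have hsplit := eVariationOn.Icc_add_Icc γ (s := Set.Icc 0 1) ht.1 ht.2 ht
  have e1 := eVariationOn.edist_le γ (s := Set.Icc 0 1 ∩ Set.Icc 0 t) (x := 0) (y := t)
    (by simp [ht.1]) (by simp [ht.1, ht.2])
  have e2 := eVariationOn.edist_le γ (s := Set.Icc 0 1 ∩ Set.Icc t 1) (x := t) (y := 1)
    (by simp [ht.1, ht.2]) (by simp [ht.2])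
  have hsum := (add_le_add e1 e2).trans_lt ((hsplit.trans (by rw [Set.inter_self])).trans_lt hγ)
  rw [h0, h1, edist_dist, edist_dist, ← ENNReal.ofReal_add dist_nonneg dist_nonneg] at hsum
  exact (ENNReal.ofReal_lt_ofReal_iff_of_nonneg (by positivity)).1 hsum

lemma isPathConnected_ball (hX : IsLengthSpace X) (x : X) {r : ℝ} (hr : 0 < r) :
    IsPathConnected (Metric.ball x r) := by
  refine ⟨x, Metric.mem_ball_self hr, fun {y} hy ↦ ?_⟩
  obtain ⟨γ, hc, h0, h1, hγ⟩ := hX.exists_path_dist_add_dist_lt (Metric.mem_ball'.1 hy)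
  refine JoinedIn.ofLine hc h0 h1 ?_
  rintro _ ⟨t, ht, rfl⟩
  rw [Metric.mem_ball']
  linarith [hγ t ht, dist_nonneg (x := γ t) (y := y)]

lemma locallyPathConnectedSpace (hX : IsLengthSpace X) : LocallyPathConnectedSpace X :=
  .of_bases (fun _ ↦ Metric.nhds_basis_ball) fun x _ hr ↦ hX.isPathConnected_ball x hr

lemma exists_dist_lt_dist_lt (hX : IsLengthSpace X) {x y : X} {r : ℝ}
    (h : dist x y < 2 * r) : ∃ m, dist m x < r ∧ dist m y < r := by
  obtain ⟨γ, hc, h0, h1, hγ⟩ := hX.exists_path_dist_add_dist_lt h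
  have hcont : ContinuousOn (fun t ↦ dist x (γ t) - dist (γ t) y) (Set.Icc 0 1) := by fun_prop
  have hmem : (0 : ℝ) ∈ Set.Icc (dist x (γ 0) - dist (γ 0) y) (dist x (γ 1) - dist (γ 1) y) := by
    simp [h0, h1]
  obtain ⟨t, ht, heq⟩ := intermediate_value_Icc zero_le_one hcont hmem
  have := hγ t ht
  simp only at heq
  exact ⟨γ t, by rw [dist_comm]; linarith, by linarith⟩

/-- A simply connected length space admits no `2δ`-approximate correspondence with the circle
when `δ < π / 4`. -/
lemma not_exists_approximation (hX : IsLengthSpace X) [SimplyConnectedSpace X] {δ : ℝ}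
    (hδ : δ < π / 4) (φ : X → IntrinsicCircle) (ψ : IntrinsicCircle → X)
    (hφ : ∀ x y, dist (φ x) (φ y) ≤ dist x y + 2 * δ)
    (hψ : ∀ θ θ', dist (ψ θ) (ψ θ') ≤ dist θ θ' + 2 * δ)
    (hφψ : ∀ x θ, dist (φ x) θ ≤ dist x (ψ θ) + 2 * δ) : False := by
  have := hX.locallyPathConnectedSpace
  have hπ := Real.pi_pos
  obtain ⟨Φ, hΦ, hloc⟩ := exists_real_lift φ fun x ↦ by
    filter_upwards [Metric.ball_mem_nhds x (by linarith : 0 < π / 2 - 2 * δ)] with y hy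
    linarith [hφ x y, Metric.mem_ball'.1 hy]
  choose w hw hwn using fun θ ↦ exists_coe_eq_abs_eq_norm (φ (ψ θ) - θ)
  have hδ0 : 0 ≤ δ := by
    have := hψ 0 0
    simp only [dist_self] at this
    linarith
  have hτ (θ : IntrinsicCircle) : ((Φ (ψ θ) - w θ : ℝ) : IntrinsicCircle) = θ := by
    rw [AddCircle.coe_sub, hw, hΦ]
    abel
  set τ : IntrinsicCircle → ℝ := fun θ ↦ Φ (ψ θ) - w θ with hτdef
  set r : ℝ := (δ + π / 4) / 2 with hr
  have hball (θ : IntrinsicCircle) {p : X} (hp : dist p (ψ θ) < r) :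
      |Φ p - τ θ| ≤ r + 2 * δ := by
    have hr0 : 0 < r := dist_nonneg.trans_lt hp
    have hstep : ∀ x ∈ Metric.ball (ψ θ) r, ∀ y ∈ Metric.ball (ψ θ) r, |Φ x - Φ y| < π / 2 →
        |Φ x - τ θ| ≤ r + 2 * δ → |Φ y - τ θ| ≤ r + 2 * δ := by
      intro x _ y hy hxy hx
      have hn : ‖((Φ y - τ θ : ℝ) : IntrinsicCircle)‖ ≤ r + 2 * δ := by
        rw [AddCircle.coe_sub, hΦ, hτ, ← dist_eq_norm]
        linarith [hφψ y θ, Metric.mem_ball.1 hy]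
      rw [abs_eq_norm_coe_of_lt hn]
      · exact hn
      · rw [abs_lt] at hxy ⊢
        rw [abs_le] at hx
        constructor <;> linarith
    refine (hX.isPathConnected_ball (ψ θ) hr0).isConnected.isPreconnected.induction₂'
      (fun x y ↦ |Φ x - τ θ| ≤ r + 2 * δ → |Φ y - τ θ| ≤ r + 2 * δ) (fun x hx ↦ ?_)
      (fun _ _ _ _ _ _ h h' ↦ h' ∘ h) (Metric.mem_ball_self hr0) hp ?_
    · filter_upwards [nhdsWithin_le_nhds (hloc x), self_mem_nhdsWithin] with y hxy hy
      exact ⟨hstep x hx y hy hxy, hstep y hy x hx (by rwa [abs_sub_comm])⟩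
    · have h := hφψ (ψ θ) θ
      rw [dist_self, dist_eq_norm, ← hwn] at h
      simp only [hτdef, sub_sub_cancel]
      linarith
  refine not_exists_local_isometry_section τ hτ (ε := 2 * (r - δ)) (by linarith)
    fun θ θ' hθ ↦ ?_
  obtain ⟨m, hm, hm'⟩ := hX.exists_dist_lt_dist_lt (x := ψ θ) (y := ψ θ') (r := r)
    (by linarith [hψ θ θ'])
  have h := abs_le.1 (hball θ hm)
  have h' := abs_le.1 (hball θ' hm')
  have hn : ‖((τ θ - τ θ' : ℝ) : IntrinsicCircle)‖ = dist θ θ' := by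
    rw [AddCircle.coe_sub, hτ, hτ, dist_eq_norm]
  rw [← hn]
  refine abs_eq_norm_coe_of_lt (a := π / 2) (by linarith) ?_
  rw [abs_lt]
  constructor <;> linarith

end IsLengthSpace

/-- **Corollary 3.** Any simply connected length space `X` satisfies
`d_GH(X, S¹) ≥ π/4`: whenever `X` and the circle `ℝ/2πℤ` (intrinsic metric) are
isometrically embedded in a common metric space `Z`, the Hausdorff distance between
their images is at least `π/4`. -/
theorem ghDist_circle_ge_pi_div_four_of_simplyConnected
    {X : Type*} [MetricSpace X] (hX : IsLengthSpace X) (hsc : SimplyConnectedSpace X)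
    {Z : Type*} [MetricSpace Z] (f : X → Z) (g : IntrinsicCircle → Z)
    (hf : Isometry f) (hg : Isometry g) :
    ENNReal.ofReal (π / 4) ≤ EMetric.hausdorffEdist (Set.range f) (Set.range g) := by
  by_contra! hlt
  obtain ⟨d, hd, hd'⟩ := exists_between hlt
  lift d to NNReal using hd'.ne_top
  have hδ : (d : ℝ) < π / 4 := by
    rwa [ENNReal.lt_ofReal_iff_toReal_lt ENNReal.coe_ne_top, ENNReal.coe_toReal] at hd'
  have hXS (x : X) : ∃ θ, dist (f x) (g θ) < d := by
    obtain ⟨_, ⟨θ, rfl⟩, h⟩ :=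
      Metric.exists_edist_lt_of_hausdorffEDist_lt (Set.mem_range_self x) hd
    exact ⟨θ, edist_lt_coe.1 h⟩
  have hSX (θ : IntrinsicCircle) : ∃ x, dist (f x) (g θ) < d := by
    obtain ⟨_, ⟨x, rfl⟩, h⟩ :=
      Metric.exists_edist_lt_of_hausdorffEDist_lt (Set.mem_range_self θ)
        (Metric.hausdorffEDist_comm.trans_lt hd)
    exact ⟨x, by rw [dist_comm]; exact edist_lt_coe.1 h⟩
  choose φ hφ using hXS
  choose ψ hψ using hSX
  refine hX.not_exists_approximation hδ φ ψ (fun x y ↦ ?_) (fun θ θ' ↦ ?_) (fun x θ ↦ ?_)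
  · rw [← hg.dist_eq, ← hf.dist_eq]
    have := dist_triangle4 (g (φ x)) (f x) (f y) (g (φ y))
    linarith [hφ x, hφ y, dist_comm (f x) (g (φ x))]
  · rw [← hg.dist_eq, ← hf.dist_eq]
    have := dist_triangle4_right (f (ψ θ)) (f (ψ θ')) (g θ) (g θ')
    linarith [hψ θ, hψ θ']
  · rw [← hg.dist_eq, ← hf.dist_eq]
    have := dist_triangle4 (g (φ x)) (f x) (f (ψ θ)) (g θ)
    linarith [hφ x, hψ θ, dist_comm (f x) (g (φ x))]

end
end

section
/- There exists a compact, simply connected geodesic metric space E such that the Gromov–Hausdorff distance between E and the circle S¹ (with its intrinsic metric) equals exactly π/4. -/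
open Real Set Metric
open scoped ENNReal unitInterval

noncomputable section

/-- The tripod with legs of lengths `3π/4`, `3π/4`, `π/4`, realized in the plane with the
supremum metric: the two long legs form a diagonal segment, and the short leg is part of the
antidiagonal. -/
def longTripod : Set (ℝ × ℝ) :=
  {p | (p.2 = p.1 ∧ |p.1| ≤ 3 * π / 4) ∨ (p.2 = -p.1 ∧ 0 ≤ p.1 ∧ p.1 ≤ π / 4)}

lemma zero_mem_longTripod : (0 : ℝ × ℝ) ∈ longTripod := by
  left
  simp only [Prod.fst_zero, Prod.snd_zero, abs_zero, true_and]
  positivity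

lemma starConvex_longTripod : StarConvex ℝ 0 longTripod := by
  rw [starConvex_zero_iff]
  rintro ⟨x, y⟩ h a ha0 ha1
  simp only [longTripod, mem_ofPred_eq, Prod.smul_mk, smul_eq_mul] at h ⊢
  rcases h with ⟨rfl, h⟩ | ⟨rfl, h0, h1⟩
  · refine Or.inl ⟨rfl, ?_⟩
    rw [abs_mul, abs_of_nonneg ha0]
    nlinarith [abs_nonneg y]
  · exact Or.inr ⟨by ring, by positivity, by nlinarith⟩

lemma isCompact_longTripod : IsCompact longTripod := by
  refine Metric.isCompact_of_isClosed_isBounded ?_ ?_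
  · refine IsClosed.union ?_ ?_
    · exact (isClosed_eq continuous_snd continuous_fst).inter
        (isClosed_le continuous_fst.abs continuous_const)
    · exact (isClosed_eq continuous_snd continuous_fst.neg).inter
        ((isClosed_le continuous_const continuous_fst).inter
          (isClosed_le continuous_fst continuous_const))
  · refine (Metric.isBounded_closedBall (x := (0 : ℝ × ℝ)) (r := 3 * π / 4)).subset ?_
    have hπ := Real.pi_pos
    rintro ⟨x, y⟩ (⟨h, h1⟩ | ⟨h, h0, h1⟩) <;> dsimp only at h h1 <;> subst h <;>
      rw [mem_closedBall_zero_iff, Prod.norm_def, max_le_iff] <;>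
      simp only [Real.norm_eq_abs, abs_neg]
    · exact ⟨h1, h1⟩
    · dsimp only at h0
      rw [abs_of_nonneg h0]
      constructor <;> linarith

/-- The variation of a `dist x y`-Lipschitz path from `x` to `y` equals `dist x y`. -/
lemma eVariationOn_eq_of_lipschitzWith {X : Type*} [MetricSpace X] {γ : ℝ → X}
    (h : LipschitzWith (nndist (γ 0) (γ 1)) γ) :
    eVariationOn γ (Icc 0 1) = ENNReal.ofReal (dist (γ 0) (γ 1)) := by
  refine le_antisymm ?_ ?_
  · have h1 := (h.lipschitzOnWith (s := Icc (0 : ℝ) 1)).comp_eVariationOn_le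
      (f := γ) (g := id) (s := Icc (0 : ℝ) 1) (fun x hx => hx)
    have h2 : eVariationOn (id : ℝ → ℝ) (Icc 0 1) = 1 := by
      simpa only [inter_self, id, sub_zero, ENNReal.ofReal_one] using
        (monotoneOn_id (s := Icc (0 : ℝ) 1)).eVariationOn_eq
          (left_mem_Icc.2 zero_le_one) (right_mem_Icc.2 zero_le_one)
    calc eVariationOn γ (Icc 0 1)
      _ ≤ nndist (γ 0) (γ 1) * eVariationOn (id : ℝ → ℝ) (Icc 0 1) := h1
      _ ≤ nndist (γ 0) (γ 1) * 1 := by rw [h2]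
      _ = ENNReal.ofReal (dist (γ 0) (γ 1)) := by
        rw [mul_one, ← edist_nndist, edist_dist]
  · rw [← edist_dist]
    exact eVariationOn.edist_le γ (left_mem_Icc.2 zero_le_one) (right_mem_Icc.2 zero_le_one)

/-- Two points of a set on an isometrically embedded segment contained in the set are joined by
a path in the set whose length is their distance. -/
lemma exists_geodesic_of_isometry {Y : Type*} [MetricSpace Y] {s : Set Y} {φ : ℝ → Y}
    (hφ : Isometry φ) {a b : ℝ} (hs : ∀ c ∈ uIcc a b, φ c ∈ s) {x y : s}
    (hx : φ a = x) (hy : φ b = y) :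
    ∃ γ : ℝ → s, ContinuousOn γ (Icc 0 1) ∧ γ 0 = x ∧ γ 1 = y ∧
      eVariationOn γ (Icc 0 1) = ENNReal.ofReal (dist x y) := by
  have hmem : ∀ t : Icc (0 : ℝ) 1, φ (AffineMap.lineMap a b (t : ℝ)) ∈ s := fun t => by
    refine hs _ ?_
    rw [← segment_eq_uIcc, segment_eq_image_lineMap]
    exact mem_image_of_mem _ t.2
  let γ : ℝ → s := fun t => ⟨_, hmem (projIcc 0 1 zero_le_one t)⟩
  have h0 : γ 0 = x := Subtype.ext (by simp [γ, hx])
  have h1 : γ 1 = y := Subtype.ext (by simp [γ, hy])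
  have hlip : LipschitzWith (nndist (γ 0) (γ 1)) γ := by
    refine LipschitzWith.of_dist_le_mul fun t u => ?_
    rw [coe_nndist, h0, h1, Subtype.dist_eq x y, ← hx, ← hy, hφ.dist_eq, Subtype.dist_eq]
    simp only [γ]
    rw [hφ.dist_eq, dist_lineMap_lineMap, mul_comm]
    gcongr
    rw [← Subtype.dist_eq, Real.dist_eq]
    exact abs_projIcc_sub_projIcc zero_le_one
  refine ⟨γ, hlip.continuous.continuousOn, h0, h1, ?_⟩
  rw [eVariationOn_eq_of_lipschitzWith hlip, h0, h1]

lemma isometry_prodMk_self : Isometry fun c : ℝ => (c, c) :=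
  Isometry.of_dist_eq fun a b => by simp [Prod.dist_eq]

lemma isometry_abs_prodMk : Isometry fun c : ℝ => (|c|, c) :=
  Isometry.of_dist_eq fun a b => by
    simp only [Prod.dist_eq, Real.dist_eq]
    exact max_eq_right (abs_abs_sub_abs_le_abs_sub a b)

lemma isometry_prodMk_neg_abs : Isometry fun c : ℝ => (c, -|c|) :=
  Isometry.of_dist_eq fun a b => by
    simp only [Prod.dist_eq, Real.dist_eq]
    refine max_eq_left ?_
    rw [neg_sub_neg, abs_sub_comm]
    exact abs_abs_sub_abs_le_abs_sub a b

lemma abs_prodMk_mem_longTripod {c : ℝ} (h : -(π / 4) ≤ c) (h' : c ≤ 3 * π / 4) :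
    (|c|, c) ∈ longTripod := by
  rcases le_total 0 c with hc | hc
  · exact Or.inl ⟨(abs_of_nonneg hc).symm, by simp [abs_of_nonneg hc, h']⟩
  · refine Or.inr ⟨by simp [abs_of_nonpos hc], abs_nonneg _, ?_⟩
    simp only [abs_of_nonpos hc]
    linarith

lemma prodMk_neg_abs_mem_longTripod {c : ℝ} (h : -(3 * π / 4) ≤ c) (h' : c ≤ π / 4) :
    (c, -|c|) ∈ longTripod := by
  rcases le_total 0 c with hc | hc
  · exact Or.inr ⟨by simp [abs_of_nonneg hc], hc, h'⟩
  · refine Or.inl ⟨by simp [abs_of_nonpos hc], ?_⟩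
    simp only [abs_of_nonpos hc]
    linarith

lemma isGeodesicSpace_longTripod : IsGeodesicSpace longTripod := by
  have hπ := Real.pi_pos
  rintro ⟨⟨a, a'⟩, ha⟩ ⟨⟨b, b'⟩, hb⟩
  have ha' := ha
  have hb' := hb
  simp only [longTripod, mem_ofPred_eq, abs_le] at ha' hb'
  rcases ha' with ⟨rfl, ha1, ha2⟩ | ⟨rfl, ha1, ha2⟩ <;>
    rcases hb' with ⟨rfl, hb1, hb2⟩ | ⟨rfl, hb1, hb2⟩
  · refine exists_geodesic_of_isometry isometry_prodMk_self (a := a') (b := b')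
      (fun c hc => Or.inl ⟨rfl, abs_le.2 ?_⟩) rfl rfl
    rw [mem_uIcc] at hc
    constructor <;> rcases hc with hc | hc <;> linarith [hc.1, hc.2]
  · rcases le_total 0 a' with h | h
    · refine exists_geodesic_of_isometry isometry_abs_prodMk (a := a') (b := -b)
        (fun c hc => ?_) (by simp [abs_of_nonneg h]) (by simp [abs_of_nonneg hb1])
      rw [mem_uIcc] at hc
      apply abs_prodMk_mem_longTripod <;> rcases hc with hc | hc <;> linarith [hc.1, hc.2]
    · refine exists_geodesic_of_isometry isometry_prodMk_neg_abs (a := a') (b := b)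
        (fun c hc => ?_) (by simp [abs_of_nonpos h]) (by simp [abs_of_nonneg hb1])
      rw [mem_uIcc] at hc
      apply prodMk_neg_abs_mem_longTripod <;> rcases hc with hc | hc <;> linarith [hc.1, hc.2]
  · rcases le_total 0 b' with h | h
    · refine exists_geodesic_of_isometry isometry_abs_prodMk (a := -a) (b := b')
        (fun c hc => ?_) (by simp [abs_of_nonneg ha1]) (by simp [abs_of_nonneg h])
      rw [mem_uIcc] at hc
      apply abs_prodMk_mem_longTripod <;> rcases hc with hc | hc <;> linarith [hc.1, hc.2]
    · refine exists_geodesic_of_isometry isometry_prodMk_neg_abs (a := a) (b := b')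
        (fun c hc => ?_) (by simp [abs_of_nonneg ha1]) (by simp [abs_of_nonpos h])
      rw [mem_uIcc] at hc
      apply prodMk_neg_abs_mem_longTripod <;> rcases hc with hc | hc <;> linarith [hc.1, hc.2]
  · refine exists_geodesic_of_isometry isometry_prodMk_neg_abs (a := a) (b := b)
      (fun c hc => ?_) (by simp [abs_of_nonneg ha1]) (by simp [abs_of_nonneg hb1])
    rw [mem_uIcc] at hc
    apply prodMk_neg_abs_mem_longTripod <;> rcases hc with hc | hc <;> linarith [hc.1, hc.2]

lemma dist_intrinsicCircle_le (x y : IntrinsicCircle) : dist x y ≤ π := by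
  have h := AddCircle.norm_le_half_period (2 * π) (x := x - y) (by positivity)
  rw [abs_of_pos (by positivity : 0 < 2 * π)] at h
  rw [dist_eq_norm]
  linarith

lemma dist_coe_intrinsicCircle {a b : ℝ} (h : |a - b| ≤ 2 * π) :
    dist (a : IntrinsicCircle) b = min |a - b| (2 * π - |a - b|) := by
  have hπ := Real.pi_pos
  have hp : (2 * π) ≠ 0 := by positivity
  have key : ∀ y : ℝ, |y| ≤ π → ‖(y : IntrinsicCircle)‖ = |y| := fun y hy =>
    (AddCircle.norm_coe_eq_abs_iff (2 * π) hp).2 (by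
      rw [abs_of_pos (by positivity : 0 < 2 * π)]; linarith)
  rw [dist_eq_norm, ← AddCircle.coe_sub]
  generalize a - b = y at *
  rcases le_total |y| π with hy | hy
  · rw [key y hy, min_eq_left (by linarith)]
  · rw [min_eq_right (by linarith)]
    rcases le_total 0 y with h0 | h0
    · rw [abs_of_nonneg h0] at *
      have hn : |y - 2 * π| = 2 * π - y := by rw [abs_of_nonpos (by linarith)]; ring
      rw [← sub_add_cancel y (2 * π), AddCircle.coe_add_period, key _ (by rw [hn]; linarith), hn,
        sub_add_cancel]
    · rw [abs_of_nonpos h0] at *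
      have hn : |y + 2 * π| = 2 * π - -y := by rw [abs_of_nonneg (by linarith)]; ring
      rw [← AddCircle.coe_add_period, key _ (by rw [hn]; linarith), hn]

/-- The relation between points of the tripod and angles that induces an optimal correspondence
with the circle. -/
def TripodAngle (p : ℝ × ℝ) (θ : ℝ) : Prop :=
  (p.2 = p.1 ∧ ((-(3 * π / 4) ≤ p.1 ∧ p.1 ≤ -(π / 4) ∧ θ = p.1 + 3 * π / 4) ∨
    (-(π / 4) ≤ p.1 ∧ p.1 ≤ 0 ∧ θ = -(π / 4) - p.1) ∨
    (0 ≤ p.1 ∧ p.1 ≤ π / 4 ∧ θ = -(3 * π / 4) - p.1) ∨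
    (π / 4 ≤ p.1 ∧ p.1 ≤ 3 * π / 4 ∧ θ = p.1 + π / 4))) ∨
  (p.2 = -p.1 ∧ 0 ≤ p.1 ∧ p.1 ≤ π / 4 ∧ (θ = -(π / 4) - p.1 ∨ θ = -(3 * π / 4) + p.1))

/-- The correspondence between the tripod and the circle induced by `TripodAngle`. -/
def tripodCorrespondence : Set (longTripod × IntrinsicCircle) :=
  {q | ∃ θ : ℝ, TripodAngle q.1 θ ∧ q.2 = θ}

lemma isCorrespondence_tripodCorrespondence : IsCorrespondence tripodCorrespondence := by
  have hπ := Real.pi_pos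
  constructor
  · rintro ⟨⟨a, a'⟩, h⟩
    suffices ∃ θ, TripodAngle (a, a') θ by
      obtain ⟨θ, hθ⟩ := this
      exact ⟨θ, θ, hθ, rfl⟩
    simp only [longTripod, mem_ofPred_eq, abs_le] at h
    rcases h with ⟨h, h1, h2⟩ | ⟨h, h1, h2⟩
    · rcases le_total a (-(π / 4)) with h3 | h3
      · exact ⟨_, Or.inl ⟨h, Or.inl ⟨h1, h3, rfl⟩⟩⟩
      rcases le_total a 0 with h4 | h4
      · exact ⟨_, Or.inl ⟨h, Or.inr (Or.inl ⟨h3, h4, rfl⟩)⟩⟩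
      rcases le_total a (π / 4) with h5 | h5
      · exact ⟨_, Or.inl ⟨h, Or.inr (Or.inr (Or.inl ⟨h4, h5, rfl⟩))⟩⟩
      · exact ⟨_, Or.inl ⟨h, Or.inr (Or.inr (Or.inr ⟨h5, h2, rfl⟩))⟩⟩
    · exact ⟨_, Or.inr ⟨h, h1, h2, Or.inl rfl⟩⟩
  · intro y
    obtain ⟨θ, ⟨hl, hr⟩, rfl⟩ := AddCircle.coe_image_Ico_eq (2 * π) (-π) ▸ mem_univ y
    suffices ∃ p ∈ longTripod, TripodAngle p θ by
      obtain ⟨p, hp, h⟩ := this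
      exact ⟨⟨p, hp⟩, θ, h, rfl⟩
    have diag : ∀ u : ℝ, -(3 * π / 4) ≤ u → u ≤ 3 * π / 4 → (u, u) ∈ longTripod :=
      fun u h1 h2 => Or.inl ⟨rfl, abs_le.2 ⟨h1, h2⟩⟩
    rcases le_total θ (-(3 * π / 4)) with h1 | h1
    · exact ⟨_, diag (-(3 * π / 4) - θ) (by linarith) (by linarith),
        Or.inl ⟨rfl, Or.inr (Or.inr (Or.inl ⟨by linarith, by linarith, by ring⟩))⟩⟩
    rcases le_total θ (-(π / 2)) with h2 | h2
    · refine ⟨(3 * π / 4 + θ, -(3 * π / 4 + θ)), Or.inr ⟨rfl, ?_, ?_⟩,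
        Or.inr ⟨rfl, ?_, ?_, Or.inr ?_⟩⟩ <;> linarith
    rcases le_total θ (-(π / 4)) with h3 | h3
    · refine ⟨(-(π / 4) - θ, -(-(π / 4) - θ)), Or.inr ⟨rfl, ?_, ?_⟩,
        Or.inr ⟨rfl, ?_, ?_, Or.inl ?_⟩⟩ <;> linarith
    rcases le_total θ 0 with h4 | h4
    · exact ⟨_, diag (-(π / 4) - θ) (by linarith) (by linarith),
        Or.inl ⟨rfl, Or.inr (Or.inl ⟨by linarith, by linarith, by ring⟩)⟩⟩
    rcases le_total θ (π / 2) with h5 | h5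
    · exact ⟨_, diag (θ - 3 * π / 4) (by linarith) (by linarith),
        Or.inl ⟨rfl, Or.inl ⟨by linarith, by linarith, by ring⟩⟩⟩
    · exact ⟨_, diag (θ - π / 4) (by linarith) (by linarith),
        Or.inl ⟨rfl, Or.inr (Or.inr (Or.inr ⟨by linarith, by linarith, by ring⟩))⟩⟩

lemma TripodAngle.abs_le_pi {p : ℝ × ℝ} {θ : ℝ} (h : TripodAngle p θ) : |θ| ≤ π := by
  have hπ := Real.pi_pos
  rw [abs_le]
  rcases h with ⟨-, h | h | h | h⟩ | ⟨-, h1, h2, h | h⟩ <;> constructor <;> linarith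

lemma TripodAngle.abs_dist_sub_le {p q : ℝ × ℝ} {θ η : ℝ} (hp : TripodAngle p θ)
    (hq : TripodAngle q η) :
    |dist p q - min |θ - η| (2 * π - |θ - η|)| ≤ π / 2 := by
  have hπ := Real.pi_pos
  obtain ⟨a, a'⟩ := p
  obtain ⟨b, b'⟩ := q
  simp only [TripodAngle] at hp hq
  simp only [Prod.dist_eq, Real.dist_eq]
  rw [abs_le]
  rcases hp with ⟨rfl, hp⟩ | ⟨rfl, hp1, hp2, hp⟩ <;>
    rcases hq with ⟨rfl, hq⟩ | ⟨rfl, hq1, hq2, hq⟩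
  · rw [max_self]
    rcases hp with ⟨h1, h2, rfl⟩ | ⟨h1, h2, rfl⟩ | ⟨h1, h2, rfl⟩ | ⟨h1, h2, rfl⟩ <;>
    rcases hq with ⟨h3, h4, rfl⟩ | ⟨h3, h4, rfl⟩ | ⟨h3, h4, rfl⟩ | ⟨h3, h4, rfl⟩ <;>
    grind
  · rcases hp with ⟨h1, h2, rfl⟩ | ⟨h1, h2, rfl⟩ | ⟨h1, h2, rfl⟩ | ⟨h1, h2, rfl⟩ <;>
    rcases hq with rfl | rfl <;> grind
  · rcases hq with ⟨h1, h2, rfl⟩ | ⟨h1, h2, rfl⟩ | ⟨h1, h2, rfl⟩ | ⟨h1, h2, rfl⟩ <;>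
    rcases hp with rfl | rfl <;> grind
  · rcases hp with rfl | rfl <;> rcases hq with rfl | rfl <;> grind

lemma distortion_tripodCorrespondence_le :
    distortion tripodCorrespondence ≤ ENNReal.ofReal (π / 2) := by
  refine iSup₂_le ?_
  rintro ⟨⟨p, x⟩, θ, hp, hx⟩ ⟨⟨q, y⟩, η, hq, hy⟩
  dsimp only at hp hq hx hy ⊢
  subst hx hy
  refine ENNReal.ofReal_le_ofReal ?_
  have h : |θ - η| ≤ 2 * π :=
    (abs_sub _ _).trans (by linarith [hp.abs_le_pi, hq.abs_le_pi])
  simpa only [Subtype.dist_eq, dist_coe_intrinsicCircle h] using hp.abs_dist_sub_le hq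

/-- A correspondence distorts any distance by at least its excess over the diameter of the
circle. -/
lemma le_distortion_intrinsicCircle {X : Type*} [MetricSpace X]
    {R : Set (X × IntrinsicCircle)} (hR : IsCorrespondence R) (p q : X) :
    ENNReal.ofReal (dist p q - π) ≤ distortion R := by
  obtain ⟨x, hx⟩ := hR.1 p
  obtain ⟨y, hy⟩ := hR.1 q
  refine le_trans (ENNReal.ofReal_le_ofReal ?_)
    (le_iSup₂_of_le (⟨(p, x), hx⟩ : R) (⟨(q, y), hy⟩ : R) le_rfl)
  exact le_trans (by linarith [dist_intrinsicCircle_le x y]) (le_abs_self _)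

lemma ghDist_longTripod_intrinsicCircle :
    ghDist longTripod IntrinsicCircle = ENNReal.ofReal (π / 4) := by
  have hπ := Real.pi_pos
  have half : ENNReal.ofReal (π / 4) = ENNReal.ofReal (π / 2) / 2 := by
    rw [show π / 4 = π / 2 / 2 by ring, ENNReal.ofReal_div_of_pos two_pos, ENNReal.ofReal_ofNat]
  rw [half, ghDist]
  congr 1
  refine le_antisymm ((iInf_le _ ⟨_, isCorrespondence_tripodCorrespondence⟩).trans
    distortion_tripodCorrespondence_le) (le_iInf fun R => ?_)
  have hmem : ∀ u : ℝ, |u| = 3 * π / 4 → (u, u) ∈ longTripod := fun u hu => Or.inl ⟨rfl, hu.le⟩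
  have h := le_distortion_intrinsicCircle R.2
    ⟨_, hmem (3 * π / 4) (abs_of_pos (by positivity))⟩
    ⟨_, hmem (-(3 * π / 4)) (by rw [abs_neg, abs_of_pos (by positivity)])⟩
  rwa [Subtype.dist_eq, isometry_prodMk_self.dist_eq, Real.dist_eq,
    abs_of_pos (by linarith : 0 < 3 * π / 4 - -(3 * π / 4)),
    show 3 * π / 4 - -(3 * π / 4) - π = π / 2 by ring] at h

/-- **Theorem 1.** There exists a compact, simply connected geodesic metric space `E`
with `d_GH(E, S¹) = π/4`, where `d_GH` is the Gromov–Hausdorff distance (expressed as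
half the infimal distortion of correspondences). -/
theorem exists_simplyConnected_geodesic_ghDist_circle_eq_pi_div_four :
    ∃ (E : Type) (mE : MetricSpace E),
      letI := mE
      Nonempty E ∧ CompactSpace E ∧ SimplyConnectedSpace E ∧ IsGeodesicSpace E ∧
        ghDist E IntrinsicCircle = ENNReal.ofReal (π / 4) := by
  have : CompactSpace longTripod := isCompact_iff_compactSpace.1 isCompact_longTripod
  have : ContractibleSpace longTripod :=
    starConvex_longTripod.contractibleSpace ⟨0, zero_mem_longTripod⟩
  exact ⟨longTripod, inferInstance, ⟨0, zero_mem_longTripod⟩, inferInstance, inferInstance,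
    isGeodesicSpace_longTripod, ghDist_longTripod_intrinsicCircle⟩


end
end

section
/- Let E be the metric tripod obtained by gluing three segments of lengths π/2, π/2 and π/4 at a common endpoint, with the induced path metric. Then there exists a correspondence R between S¹ and E whose distortion is at most π/2; consequently d_GH(E, S¹) ≤ π/4. -/
open Real Set Metric
open scoped ENNReal unitInterval

noncomputable section

/-- The point at distance `t` from the centre on the `i`-th coordinate axis. -/
def axisPoint (i : Fin 3) (t : ℝ) : PiLp 1 fun _ : Fin 3 => ℝ :=
  (WithLp.equiv 1 (∀ _ : Fin 3, ℝ)).symm (fun j => if j = i then t else 0)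

lemma dist_axisPoint {i j : Fin 3} {s t : ℝ} (hs : 0 ≤ s) (ht : 0 ≤ t) :
    dist (axisPoint i s) (axisPoint j t) = if i = j then |s - t| else s + t := by
  rw [PiLp.dist_eq_of_L1]
  fin_cases i <;> fin_cases j <;>
    simp [axisPoint, Fin.sum_univ_three, Real.dist_eq, abs_of_nonneg, hs, ht, add_comm]

lemma AddCircle.dist_coe_eq_min {p : ℝ} (hp : 0 < p) {x y : ℝ} (h : |x - y| ≤ p) :
    dist (x : AddCircle p) (y : AddCircle p) = min |x - y| (p - |x - y|) := by
  wlog hxy : y ≤ x generalizing x y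
  · rw [dist_comm, abs_sub_comm]
    exact this (by rwa [abs_sub_comm]) (le_of_not_ge hxy)
  rw [abs_of_nonneg (sub_nonneg.2 hxy)] at h ⊢
  rw [dist_eq_norm, ← AddCircle.coe_sub]
  rcases le_total (x - y) (p / 2) with h' | h'
  · rw [(AddCircle.norm_coe_eq_abs_iff p hp.ne').2, abs_of_nonneg (sub_nonneg.2 hxy), min_eq_left]
    · linarith
    · rwa [abs_of_nonneg (sub_nonneg.2 hxy), abs_of_pos hp]
  · have hcoe : ((x - y : ℝ) : AddCircle p) = ((x - y - p : ℝ) : AddCircle p) := by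
      rw [AddCircle.coe_sub (p := p) (x := x - y), AddCircle.coe_period, sub_zero]
    rw [hcoe, (AddCircle.norm_coe_eq_abs_iff p hp.ne').2, abs_of_nonpos (by linarith), min_eq_right]
    · ring
    · linarith
    · rw [abs_of_nonpos (by linarith), abs_of_pos hp]
      linarith

/-- `TripodMatch h u i t` matches the parameter `u ∈ [0, 8h]` of a circle of length `8h` with the
point at distance `t` from the centre on the `i`-th leg of a tripod with legs `2h, 2h, h`. -/
def TripodMatch (h u : ℝ) (i : Fin 3) (t : ℝ) : Prop :=
  (i = 0 ∧ 0 ≤ u ∧ u ≤ 2 * h ∧ t = u) ∨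
  (i = 0 ∧ 2 * h ≤ u ∧ u ≤ 3 * h ∧ t = 4 * h - u) ∨
  (i = 1 ∧ 3 * h ≤ u ∧ u ≤ 4 * h ∧ t = u - 2 * h) ∨
  (i = 1 ∧ 4 * h ≤ u ∧ u ≤ 5 * h ∧ t = 2 * h) ∨
  (i = 1 ∧ 5 * h ≤ u ∧ u ≤ 6 * h ∧ t = 6 * h - u) ∨
  (i = 2 ∧ 6 * h ≤ u ∧ u ≤ 7 * h ∧ t = h) ∨
  (i = 2 ∧ 7 * h ≤ u ∧ u ≤ 8 * h ∧ t = 8 * h - u)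

namespace TripodMatch

variable {h u v s t : ℝ} {i j : Fin 3}

lemma nonneg (hh : 0 ≤ h) (hu : TripodMatch h u i t) : 0 ≤ t := by
  rcases hu with H | H | H | H | H | H | H <;> linarith [H.2.1, H.2.2.1, H.2.2.2]

lemma mem_Icc (hh : 0 ≤ h) (hu : TripodMatch h u i t) : u ∈ Icc 0 (8 * h) := by
  rcases hu with H | H | H | H | H | H | H <;> constructor <;> linarith [H.2.1, H.2.2.1]

lemma exists_of_mem_Icc (hu : u ∈ Icc 0 (8 * h)) : ∃ i t, TripodMatch h u i t := by
  obtain ⟨h₀, h₈⟩ := hu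
  unfold TripodMatch
  rcases le_total u (2 * h) with h₂ | h₂
  · exact ⟨0, _, .inl ⟨rfl, h₀, h₂, rfl⟩⟩
  rcases le_total u (3 * h) with h₃ | h₃
  · exact ⟨0, _, .inr <| .inl ⟨rfl, h₂, h₃, rfl⟩⟩
  rcases le_total u (4 * h) with h₄ | h₄
  · exact ⟨1, _, .inr <| .inr <| .inl ⟨rfl, h₃, h₄, rfl⟩⟩
  rcases le_total u (5 * h) with h₅ | h₅
  · exact ⟨1, _, .inr <| .inr <| .inr <| .inl ⟨rfl, h₄, h₅, rfl⟩⟩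
  rcases le_total u (6 * h) with h₆ | h₆
  · exact ⟨1, _, .inr <| .inr <| .inr <| .inr <| .inl ⟨rfl, h₅, h₆, rfl⟩⟩
  rcases le_total u (7 * h) with h₇ | h₇
  · exact ⟨2, _, .inr <| .inr <| .inr <| .inr <| .inr <| .inl ⟨rfl, h₆, h₇, rfl⟩⟩
  · exact ⟨2, _, .inr <| .inr <| .inr <| .inr <| .inr <| .inr ⟨rfl, h₇, h₈, rfl⟩⟩

lemma exists_param (ht : 0 ≤ t) (hti : t ≤ ![2 * h, 2 * h, h] i) : ∃ u, TripodMatch h u i t := by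
  unfold TripodMatch
  fin_cases i <;> simp at hti
  · exact ⟨t, .inl ⟨rfl, ht, hti, rfl⟩⟩
  · rcases le_total t h with h' | h'
    · exact ⟨6 * h - t, .inr <| .inr <| .inr <| .inr <| .inl
        ⟨rfl, by linarith, by linarith, by ring⟩⟩
    · exact ⟨t + 2 * h, .inr <| .inr <| .inl ⟨rfl, by linarith, by linarith, by ring⟩⟩
  · exact ⟨8 * h - t, .inr <| .inr <| .inr <| .inr <| .inr <| .inr
      ⟨rfl, by linarith, by linarith, by ring⟩⟩

lemma leg_bound (hh : 0 ≤ h) (hu : TripodMatch h u i t) : t ≤ ![2 * h, 2 * h, h] i := by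
  rcases hu with H | H | H | H | H | H | H <;> obtain ⟨rfl, h₁, h₂, rfl⟩ := H <;> simp <;> linarith

lemma abs_min_sub_le (hh : 0 ≤ h) (hu : TripodMatch h u i s) (hv : TripodMatch h v j t) :
    |min |u - v| (8 * h - |u - v|) - (if i = j then |s - t| else s + t)| ≤ 2 * h := by
  rcases hu with H | H | H | H | H | H | H <;> obtain ⟨rfl, h₁, h₂, rfl⟩ := H <;>
  rcases hv with H | H | H | H | H | H | H <;> obtain ⟨rfl, h₃, h₄, rfl⟩ := H <;>
  simp only [Fin.isValue, Fin.reduceEq, if_true, if_false] <;>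
  grind

end TripodMatch

/-- The correspondence between the circle and the tripod given by `TripodMatch`. -/
def circleTripodRel : Set (IntrinsicCircle × TripodE) :=
  {q | ∃ u i t, TripodMatch (π / 4) u i t ∧ (u : IntrinsicCircle) = q.1 ∧ axisPoint i t = q.2}

lemma tripodLeg_eq : tripodLeg = ![2 * (π / 4), 2 * (π / 4), π / 4] := by
  rw [tripodLeg]
  ring_nf

lemma isCorrespondence_circleTripodRel : IsCorrespondence circleTripodRel := by
  constructor
  · intro x
    obtain ⟨u, hu, rfl⟩ := AddCircle.eq_coe_Ico x
    obtain ⟨i, t, h⟩ := TripodMatch.exists_of_mem_Icc (h := π / 4) (u := u)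
      ⟨hu.1, by linarith [hu.2]⟩
    have hπ : 0 ≤ π / 4 := by positivity
    exact ⟨⟨axisPoint i t, i, t, h.nonneg hπ, tripodLeg_eq ▸ h.leg_bound hπ, rfl⟩,
      u, i, t, h, rfl, rfl⟩
  · rintro ⟨_, i, t, ht, hti, rfl⟩
    obtain ⟨u, hu⟩ := TripodMatch.exists_param ht (tripodLeg_eq ▸ hti)
    exact ⟨u, u, i, t, hu, rfl, rfl⟩

lemma distortion_circleTripodRel_le : distortion circleTripodRel ≤ ENNReal.ofReal (π / 2) := by
  refine iSup₂_le ?_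
  rintro ⟨⟨x, y⟩, u, i, s, hu, hx, hy⟩ ⟨⟨w, z⟩, v, j, t, hv, hw, hz⟩
  have hπ : 0 ≤ π / 4 := by positivity
  have hu' := hu.mem_Icc hπ
  have hv' := hv.mem_Icc hπ
  apply ENNReal.ofReal_le_ofReal
  dsimp only at hx hy hw hz ⊢
  rw [← hx, ← hw, AddCircle.dist_coe_eq_min two_pi_pos (abs_sub_le_iff.2
    ⟨by linarith [hu'.2, hv'.1], by linarith [hu'.1, hv'.2]⟩), Subtype.dist_eq, ← hy, ← hz,
    dist_axisPoint (hu.nonneg hπ) (hv.nonneg hπ)]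
  convert hu.abs_min_sub_le hπ hv using 1
  · ring_nf
  · ring

section Swap

variable {X Y : Type*} {R : Set (X × Y)}

lemma IsCorrespondence.preimage_swap (hR : IsCorrespondence R) :
    IsCorrespondence (Prod.swap ⁻¹' R) :=
  ⟨hR.2, hR.1⟩

lemma distortion_preimage_swap_le [MetricSpace X] [MetricSpace Y] :
    distortion (Prod.swap ⁻¹' R) ≤ distortion R := by
  refine iSup₂_le fun p q => ?_
  rw [abs_sub_comm]
  exact le_iSup₂_of_le (f := fun p q : R => ENNReal.ofReal
    |dist (p : X × Y).1 (q : X × Y).1 - dist (p : X × Y).2 (q : X × Y).2|)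
    ⟨_, p.2⟩ ⟨_, q.2⟩ le_rfl

lemma ghDist_le_of_distortion_le [MetricSpace X] [MetricSpace Y] {r : ℝ}
    (hR : IsCorrespondence R) (h : distortion R ≤ ENNReal.ofReal (2 * r)) :
    ghDist X Y ≤ ENNReal.ofReal r := by
  refine ENNReal.div_le_of_le_mul ?_
  rw [mul_comm, ← ENNReal.ofReal_ofNat 2, ← ENNReal.ofReal_mul zero_le_two]
  exact iInf_le_of_le ⟨R, hR⟩ h

end Swap

/-- **Claim 5.** There is a correspondence between `S¹` and the tripod `E` (legs of
lengths `π/2, π/2, π/4`) with distortion at most `π/2`; consequently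
`d_GH(E, S¹) ≤ π/4`. -/
theorem exists_correspondence_circle_tripod_distortion_le :
    (∃ R : Set (IntrinsicCircle × TripodE), IsCorrespondence R ∧
        distortion R ≤ ENNReal.ofReal (π / 2)) ∧
      ghDist TripodE IntrinsicCircle ≤ ENNReal.ofReal (π / 4) := by
  refine ⟨⟨_, isCorrespondence_circleTripodRel, distortion_circleTripodRel_le⟩,
    ghDist_le_of_distortion_le isCorrespondence_circleTripodRel.preimage_swap
      (distortion_preimage_swap_le.trans (distortion_circleTripodRel_le.trans_eq ?_))⟩
  ring_nf

end
end

section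
/- Let (Y, d_Y) be a length space such that, for some constant C > 0, every loop of diameter < C in Y is nulhomotopic in Y, and let y₀ ∈ Y. Then any two loops β, β' : [0,1] → Y based at y₀ satisfying d_Y(β(t), β'(t)) < C for all t ∈ [0,1] are path-homotopic (homotopic relative to the basepoint). -/
open Real Set Metric
open scoped ENNReal unitInterval

noncomputable section

/-- In a length space, two points are joined by a path whose points have total distance to the
endpoints at most any prescribed bound larger than the distance between the endpoints. -/
theorem IsLengthSpace.exists_path_dist_add_dist_le {Y : Type*} [MetricSpace Y]
    (hY : IsLengthSpace Y) {a b : Y} {L : ℝ} (hL : dist a b < L) :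
    ∃ p : Path a b, ∀ t, dist (p t) a + dist (p t) b ≤ L := by
  have hL0 : 0 < L := dist_nonneg.trans_lt hL
  have h := (ENNReal.ofReal_lt_ofReal_iff hL0).2 hL
  rw [hY a b] at h
  simp only [iInf_lt_iff] at h
  obtain ⟨γ, ⟨hγ, h0, h1⟩, hlen⟩ := h
  refine ⟨⟨⟨fun t => γ t, hγ.comp_continuous continuous_subtype_val fun t => t.2⟩, by simpa using h0,
    by simpa using h1⟩, fun t => ?_⟩
  have hadd := eVariationOn.Icc_add_Icc γ (s := Icc 0 1) t.2.1 t.2.2 t.2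
  rw [Set.inter_self] at hadd
  have hle : edist (γ t) a + edist (γ t) b ≤ ENNReal.ofReal L := by
    refine (add_le_add ?_ ?_).trans (hadd.trans_le hlen.le)
    · rw [← h0]
      exact eVariationOn.edist_le γ ⟨t.2, t.2.1, le_rfl⟩ ⟨⟨le_rfl, zero_le_one⟩, le_rfl, t.2.1⟩
    · rw [← h1]
      exact eVariationOn.edist_le γ ⟨t.2, le_rfl, t.2.2⟩ ⟨⟨zero_le_one, le_rfl⟩, t.2.2, le_rfl⟩
  rw [edist_dist, edist_dist, ← ENNReal.ofReal_add dist_nonneg dist_nonneg,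
    ENNReal.ofReal_le_ofReal_iff hL0.le] at hle
  exact hle

/-- A based loop which is freely nulhomotopic is path-homotopic to the constant path. -/
theorem IsNullLoop.path_homotopic_refl {Y : Type*} [TopologicalSpace Y] {y : Y} {γ : Path y y}
    (h : IsNullLoop γ.toContinuousMap) : γ.Homotopic (Path.refl y) := by
  obtain ⟨z, H, h0, h1, hH⟩ := h
  let F : γ.toContinuousMap.Homotopy (ContinuousMap.const _ z) := ⟨H, h0, h1⟩
  have hsq := (Path.Homotopic.map_trans_evalAt F Path.id).pathCast γ.source.symm
    (show z = ContinuousMap.const unitInterval z 1 from rfl)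
  let e : Path y z := (F.evalAt 0).cast γ.source.symm rfl
  have hγ : (γ.trans e).Homotopic (e.trans (Path.refl z)) := by
    convert hsq using 1
    · ext t
      simp only [Path.cast_coe, Path.trans_apply]
      split_ifs
      · rfl
      · exact hH _
    · ext t
      simp only [Path.cast_coe, Path.trans_apply]
      split_ifs <;> rfl
  rw [← Path.Homotopic.Quotient.eq] at hγ ⊢
  have := congrArg (fun q => q.trans (Path.Homotopic.Quotient.mk e).symm) hγ
  simpa using this

/-- If all loops of diameter less than `C` are nulhomotopic, then paths with common endpoints
that lie in a common set of diameter less than `C` are homotopic. -/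
theorem Path.homotopic_of_dist_le {Y : Type*} [MetricSpace Y] {C M : ℝ} (hM : M < C)
    (hloops : ∀ γ : C(unitInterval, Y), IsLoop γ → Metric.diam (Set.range γ) < C →
      IsNullLoop γ)
    {S : Set Y} (hS : ∀ x ∈ S, ∀ y ∈ S, dist x y ≤ M) {x y : Y} {p q : Path x y}
    (hp : range p ⊆ S) (hq : range q ⊆ S) : p.Homotopic q := by
  have hM0 : 0 ≤ M := dist_nonneg.trans (hS _ (hp ⟨0, rfl⟩) _ (hp ⟨0, rfl⟩))
  have hrange : range (p.trans q.symm) ⊆ S := by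
    rw [Path.trans_range, Path.symm_range]
    exact union_subset hp hq
  have h : (p.trans q.symm).Homotopic (Path.refl x) := by
    refine (hloops _ ?_ ?_).path_homotopic_refl
    · simp [IsLoop]
    · exact (Metric.diam_le_of_forall_dist_le hM0 fun x hx y hy =>
        hS x (hrange hx) y (hrange hy)).trans_lt hM
  rw [← Path.Homotopic.Quotient.eq] at h ⊢
  have := congrArg (fun r => r.trans (Path.Homotopic.Quotient.mk q)) h
  simpa using this

/-- A quadrilateral commutes up to homotopy when two opposite sides `p`, `p'` are short and the other
two sides `r`, `r'` stay in small ellipses around their endpoints. -/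
theorem Path.homotopic_square_of_dist_le {Y : Type*} [MetricSpace Y] {C L ε : ℝ}
    (hLC : L + 2 * ε < C)
    (hloops : ∀ γ : C(unitInterval, Y), IsLoop γ → Metric.diam (Set.range γ) < C →
      IsNullLoop γ)
    {a b a' b' : Y} {p : Path a b} {p' : Path a' b'} {r : Path a a'} {r' : Path b b'}
    (hp : ∀ t, dist (p t) a ≤ ε) (hp' : ∀ t, dist (p' t) a' ≤ ε)
    (hr : ∀ t, dist (r t) a + dist (r t) a' ≤ L)
    (hr' : ∀ t, dist (r' t) b + dist (r' t) b' ≤ L) :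
    (p.trans r').Homotopic (r.trans p') := by
  have hε : 0 ≤ ε := dist_nonneg.trans (hp 0)
  have hab : dist b a ≤ ε := by simpa using hp 1
  have hab' : dist b' a' ≤ ε := by simpa using hp' 1
  have haa : dist a a' ≤ L := by simpa using hr 0
  refine Path.homotopic_of_dist_le hLC hloops (S := {z | dist z a + dist z a' ≤ L + 2 * ε})
    (fun x hx y hy => ?_) ?_ ?_
  · simp only [mem_ofPred_eq] at hx hy
    linarith [dist_triangle_right x y a, dist_triangle_right x y a']
  · rw [Path.trans_range]
    rintro _ (⟨t, rfl⟩ | ⟨t, rfl⟩) <;> simp only [mem_ofPred_eq]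
    · linarith [hp t, dist_triangle (p t) a a']
    · linarith [hr' t, dist_triangle (r' t) b a, dist_triangle (r' t) b' a']
  · rw [Path.trans_range]
    rintro _ (⟨t, rfl⟩ | ⟨t, rfl⟩) <;> simp only [mem_ofPred_eq]
    · linarith [hr t]
    · linarith [hp' t, dist_triangle (p' t) a' a, dist_comm a a']

/-- If `γ` moves points at distance less than `δ` by at most `ε`, then so does each subpath of
length less than `δ`. -/
theorem Path.dist_subpath_le {Y : Type*} [MetricSpace Y] {a b : Y} {γ : Path a b} {δ ε : ℝ}
    (h : ∀ s t : unitInterval, dist s t < δ → dist (γ s) (γ t) ≤ ε) {s t : unitInterval}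
    (hst : s ≤ t) (hδ : (t : ℝ) - s < δ) (u : unitInterval) :
    dist (γ.subpath s t u) (γ s) ≤ ε := by
  have hu : γ.subpath s t u ∈ γ '' Icc s t := by
    rw [← Path.range_subpath_of_le γ s t hst]
    exact mem_range_self u
  obtain ⟨v, ⟨hsv, hvt⟩, hv⟩ := hu
  rw [← hv]
  refine h v s ?_
  have hsv : (s : ℝ) ≤ v := hsv
  have hvt : (v : ℝ) ≤ t := hvt
  rw [Subtype.dist_eq, Real.dist_eq, abs_of_nonneg (by linarith)]
  linarith

/-- **Lemma (2.1).** If `Y` is a length space in which every loop of diameter `< C` is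
nulhomotopic, then any two loops `β, β'` based at `y₀` with `d_Y(β(t), β'(t)) < C` for
all `t` are path-homotopic. -/
theorem loops_homotopic_of_close {Y : Type*} [MetricSpace Y] (hY : IsLengthSpace Y)
    (C : ℝ) (hC : 0 < C)
    (hloops : ∀ γ : C(unitInterval, Y), IsLoop γ → Metric.diam (Set.range γ) < C →
      IsNullLoop γ)
    (y₀ : Y) (β β' : Path y₀ y₀)
    (hclose : ∀ t : unitInterval, dist (β t) (β' t) < C) :
    β.Homotopic β' := by
  obtain ⟨t₀, -, ht₀⟩ := isCompact_univ.exists_isMaxOn univ_nonempty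
    (show Continuous fun t => dist (β t) (β' t) by fun_prop).continuousOn
  set d := dist (β t₀) (β' t₀)
  have hd : ∀ t, dist (β t) (β' t) ≤ d := fun t => ht₀ (mem_univ t)
  have hdC : d < C := hclose t₀
  have hd0 : 0 ≤ d := dist_nonneg
  obtain ⟨ε, hε, hεC⟩ : ∃ ε > 0, d + ε + 2 * ε < C := ⟨(C - d) / 4, by linarith, by linarith⟩
  have hunif : ∀ γ : Path y₀ y₀, ∃ δ > 0, ∀ s t, dist s t < δ → dist (γ s) (γ t) ≤ ε := by
    intro γ
    obtain ⟨δ, hδ, h⟩ := Metric.uniformContinuous_iff.1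
      (CompactSpace.uniformContinuous_of_continuous γ.continuous) ε hε
    exact ⟨δ, hδ, fun s t hst => (h hst).le⟩
  obtain ⟨δ₁, hδ₁, h₁⟩ := hunif β
  obtain ⟨δ₂, hδ₂, h₂⟩ := hunif β'
  obtain ⟨δ, hδ, hδδ₁, hδδ₂⟩ : ∃ δ > 0, δ < δ₁ ∧ δ < δ₂ :=
    (exists_between (lt_min hδ₁ hδ₂)).imp fun δ h => ⟨h.1, lt_min_iff.1 h.2⟩
  let c : Path (β 0) (β' 0) := (Path.refl y₀).cast β.source β'.source
  have hc : ∀ t, dist (c t) (β 0) + dist (c t) (β' 0) ≤ d + ε := by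
    intro t
    simp only [c, Path.cast_coe, Path.refl_apply, Path.source, dist_self]
    linarith
  have hstep : ∀ n : ℕ, ∀ t : unitInterval, (t : ℝ) ≤ n * δ → ∀ r : Path (β t) (β' t),
      (∀ u, dist (r u) (β t) + dist (r u) (β' t) ≤ d + ε) →
        ((β.subpath 0 t).trans r).Homotopic (c.trans (β'.subpath 0 t)) := by
    intro n
    induction n with
    | zero =>
      intro t ht r hr
      obtain rfl : t = 0 := le_antisymm (Subtype.coe_le_coe.1 (by simpa using ht)) t.2.1
      exact Path.homotopic_square_of_dist_le hεC hloops (by simp [hε.le]) (by simp [hε.le]) hc hr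
    | succ n ih =>
      intro t ht r hr
      push_cast at ht
      let s : unitInterval := ⟨max (t - δ) 0, le_max_right _ _,
        max_le (by linarith [t.2.2]) zero_le_one⟩
      have hst : s ≤ t := max_le (by linarith) t.2.1
      have hts : (t : ℝ) - s ≤ δ := by linarith [le_max_left ((t : ℝ) - δ) 0]
      have hs : (s : ℝ) ≤ n * δ := max_le (by linarith) (by positivity)
      obtain ⟨q, hq⟩ := hY.exists_path_dist_add_dist_le ((hd s).trans_lt (lt_add_of_pos_right d hε))
      have hsq := Path.homotopic_square_of_dist_le hεC hloops
        (Path.dist_subpath_le h₁ hst (hts.trans_lt hδδ₁))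
        (Path.dist_subpath_le h₂ hst (hts.trans_lt hδδ₂)) hq hr
      have hprev := ih s hs q hq
      have hβ : (β.subpath 0 t).Homotopic _ := ⟨(Path.Homotopy.subpathTransSubpath β 0 s t).symm⟩
      have hβ' : (β'.subpath 0 t).Homotopic _ :=
        ⟨(Path.Homotopy.subpathTransSubpath β' 0 s t).symm⟩
      rw [← Path.Homotopic.Quotient.eq] at *
      simp only [Path.Homotopic.Quotient.mk_trans] at *
      rw [hβ, hβ', Path.Homotopic.Quotient.trans_assoc, hsq,
        ← Path.Homotopic.Quotient.trans_assoc, hprev, Path.Homotopic.Quotient.trans_assoc]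
  obtain ⟨n, hn⟩ := exists_nat_ge (1 / δ)
  let c' : Path (β 1) (β' 1) := (Path.refl y₀).cast β.target β'.target
  have hfin := hstep n 1 ((div_le_iff₀ hδ).1 hn) c' (by
    intro t
    simp only [c', Path.cast_coe, Path.refl_apply, Path.target, dist_self]
    linarith)
  have hcast : (β.trans (Path.refl y₀)).Homotopic ((Path.refl y₀).trans β') := by
    convert hfin.pathCast β.source.symm β'.target.symm using 1
    · ext t
      simp [c', Path.trans_apply]
    · ext t
      simp [c, Path.trans_apply]
  rw [← Path.Homotopic.Quotient.eq] at hcast ⊢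
  simpa using hcast

end
end

section
/- Let (X, d_X) and (Y, d_Y) be length spaces isometrically embedded into a metric space (Z, d_Z), let D > 0 be such that the Hausdorff distance in Z between X and Y is strictly less than D, and let x₀ ∈ X, y₀ ∈ Y be points with d_Z(x₀, y₀) < D. Then for every loop α : [0,1] → X based at x₀ there exists a loop β : [0,1] → Y based at y₀ such that d_Z(α(t), β(t)) < 2D for all t ∈ [0,1]. -/
open Real Set Metric
open scoped ENNReal unitInterval

noncomputable section

/-- In a length space, two points at distance less than `ℓ` are joined, over any nondegenerate
interval, by a path each of whose points has distances to the two endpoints adding up to less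
than `ℓ`. -/
theorem IsLengthSpace.exists_path_dist_add_dist_lt_s6 {Y : Type*} [MetricSpace Y]
    (hY : IsLengthSpace Y) {y y' : Y} {ℓ : ℝ} (h : dist y y' < ℓ) {a b : ℝ} (hab : a < b) :
    ∃ β : ℝ → Y, ContinuousOn β (Icc a b) ∧ β a = y ∧ β b = y' ∧
      ∀ t ∈ Icc a b, dist y (β t) + dist (β t) y' < ℓ := by
  have hℓ : 0 < ℓ := dist_nonneg.trans_lt h
  have hlt : ENNReal.ofReal (dist y y') < ENNReal.ofReal ℓ :=
    (ENNReal.ofReal_lt_ofReal_iff hℓ).2 h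
  rw [hY y y'] at hlt
  simp only [iInf_lt_iff] at hlt
  obtain ⟨γ, ⟨hγ, h0, h1⟩, hvar⟩ := hlt
  have hba : 0 < b - a := sub_pos.2 hab
  have hmaps : MapsTo (fun t => (t - a) / (b - a)) (Icc a b) (Icc 0 1) := fun t ht =>
    ⟨div_nonneg (sub_nonneg.2 ht.1) hba.le, (div_le_one hba).2 (by linarith [ht.2])⟩
  refine ⟨fun t => γ ((t - a) / (b - a)), hγ.comp (by fun_prop) hmaps, by simp [h0],
    by simp [div_self hba.ne', h1], fun t ht => ?_⟩
  obtain ⟨hs0, hs1⟩ := hmaps ht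
  set s := (t - a) / (b - a)
  have hsum : edist y (γ s) + edist (γ s) y' ≤ eVariationOn γ (Icc 0 1) := by
    have hsplit := eVariationOn.Icc_add_Icc γ (s := univ) hs0 hs1 (mem_univ s)
    simp only [univ_inter] at hsplit
    rw [← hsplit, ← h0, ← h1]
    exact add_le_add
      (eVariationOn.edist_le γ (left_mem_Icc.2 hs0) (right_mem_Icc.2 hs0))
      (eVariationOn.edist_le γ (left_mem_Icc.2 hs1) (right_mem_Icc.2 hs1))
  have hsum' := hsum.trans_lt hvar
  rw [edist_dist, edist_dist, ← ENNReal.ofReal_add dist_nonneg dist_nonneg] at hsum'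
  exact (ENNReal.ofReal_lt_ofReal_iff hℓ).1 hsum'

/-- Any two points of `Y` that are `r`-close to `f a` and `f b` are joined by a path over `[a, b]`
that stays `R`-close to `f`. -/
def HasCloseLift {Y Z : Type*} [MetricSpace Y] [MetricSpace Z] (f : ℝ → Z) (g : Y → Z)
    (r R a b : ℝ) : Prop :=
  ∀ y y' : Y, dist (f a) (g y) < r → dist (f b) (g y') < r →
    ∃ β : ℝ → Y, ContinuousOn β (Icc a b) ∧ β a = y ∧ β b = y' ∧
      ∀ t ∈ Icc a b, dist (f t) (g (β t)) < R

theorem HasCloseLift.trans {Y Z : Type*} [MetricSpace Y] [MetricSpace Z] {f : ℝ → Z} {g : Y → Z}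
    {r R a b c : ℝ} (hab : a ≤ b) (hbc : b ≤ c) (h₁ : HasCloseLift f g r R a b)
    (h₂ : HasCloseLift f g r R b c) (hb : ∃ y, dist (f b) (g y) < r) :
    HasCloseLift f g r R a c := by
  intro y y' hy hy'
  obtain ⟨z, hz⟩ := hb
  obtain ⟨β₁, hc₁, ha₁, hb₁, hd₁⟩ := h₁ y z hy hz
  obtain ⟨β₂, hc₂, hb₂, hcc₂, hd₂⟩ := h₂ z y' hz hy'
  let β : ℝ → Y := fun t => if t ≤ b then β₁ t else β₂ t
  have e₁ : EqOn β β₁ (Icc a b) := fun t ht => if_pos ht.2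
  have e₂ : EqOn β β₂ (Icc b c) := by
    intro t ht
    rcases ht.1.eq_or_lt with rfl | hlt
    · simp [β, hb₁, hb₂]
    · exact if_neg hlt.not_ge
  refine ⟨β, ?_, (e₁ (left_mem_Icc.2 hab)).trans ha₁, (e₂ (right_mem_Icc.2 hbc)).trans hcc₂, ?_⟩
  · rw [← Icc_union_Icc_eq_Icc hab hbc]
    exact (hc₁.congr e₁).union_of_isClosed (hc₂.congr e₂) isClosed_Icc isClosed_Icc
  · intro t ht
    rw [← Icc_union_Icc_eq_Icc hab hbc] at ht
    rcases ht with ht | ht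
    · rw [e₁ ht]; exact hd₁ t ht
    · rw [e₂ ht]; exact hd₂ t ht

/-- Close lifts exist over intervals on which `f` oscillates little. -/
theorem IsLengthSpace.hasCloseLift {Y Z : Type*} [MetricSpace Y] [MetricSpace Z]
    (hY : IsLengthSpace Y) {f : ℝ → Z} {g : Y → Z} (hg : Isometry g) {r ε a b : ℝ} (hab : a < b)
    (hf : ∀ s ∈ Icc a b, ∀ t ∈ Icc a b, dist (f s) (f t) < ε) :
    HasCloseLift f g r (2 * r + 2 * ε) a b := by
  intro y y' hy hy'
  have ha := left_mem_Icc.2 hab.le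
  have hb := right_mem_Icc.2 hab.le
  have hyy' : dist y y' < 2 * r + ε := by
    rw [← hg.dist_eq]
    linarith [dist_triangle4 (g y) (f a) (f b) (g y'), dist_comm (g y) (f a), hf a ha b hb]
  obtain ⟨β, hc, h0, h1, hd⟩ := hY.exists_path_dist_add_dist_lt_s6 hyy' hab
  refine ⟨β, hc, h0, h1, fun t ht => ?_⟩
  have hsum := hd t ht
  rw [← hg.dist_eq y, ← hg.dist_eq _ y', dist_comm _ (g y')] at hsum
  linarith [dist_triangle4 (f t) (f a) (g y) (g (β t)), hf t ht a ha,
    dist_triangle4 (f t) (f b) (g y') (g (β t)), hf t ht b hb,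
    (dist_nonneg (x := f a) (y := f a)).trans_lt (hf a ha a ha)]

/-- A path in `Z` all of whose points are `r`-close to an isometrically embedded length space
has close lifts. -/
theorem IsLengthSpace.hasCloseLift_of_continuous {Y Z : Type*} [MetricSpace Y] [MetricSpace Z]
    (hY : IsLengthSpace Y) {f : ℝ → Z} (hf : Continuous f) {g : Y → Z} (hg : Isometry g)
    {r R : ℝ} (hrR : 2 * r < R) (hr : ∀ t, ∃ y, dist (f t) (g y) < r) :
    HasCloseLift f g r R 0 1 := by
  obtain ⟨ε, rfl⟩ : ∃ ε, R = 2 * r + 2 * ε := ⟨(R - 2 * r) / 2, by ring⟩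
  have hε : 0 < ε := by linarith
  obtain ⟨δ, hδ, hosc⟩ := Metric.uniformContinuousOn_iff.1
    (isCompact_Icc.uniformContinuousOn_of_continuous (hf.continuousOn (s := Icc 0 1))) ε hε
  obtain ⟨n, hn⟩ := exists_nat_one_div_lt hδ
  have hn0 : (0 : ℝ) < n + 1 := by positivity
  have step : ∀ k : ℕ, k ≤ n →
      HasCloseLift f g r (2 * r + 2 * ε) (k / (n + 1)) ((k + 1) / (n + 1)) := by
    intro k hk
    have hk' : (k : ℝ) ≤ n := by exact_mod_cast hk
    have hlen : ((k : ℝ) + 1) / (n + 1) = k / (n + 1) + 1 / (n + 1) := add_div ..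
    have h0 : (0 : ℝ) ≤ k / (n + 1) := by positivity
    have h1 : ((k : ℝ) + 1) / (n + 1) ≤ 1 := (div_le_one hn0).2 (by linarith)
    refine hY.hasCloseLift hg (by gcongr; linarith) fun s hs t ht =>
      hosc s ⟨h0.trans hs.1, hs.2.trans h1⟩ t ⟨h0.trans ht.1, ht.2.trans h1⟩ ?_
    rw [Real.dist_eq, abs_lt]
    constructor <;> linarith [hs.1, hs.2, ht.1, ht.2]
  have key : ∀ k : ℕ, k ≤ n →
      HasCloseLift f g r (2 * r + 2 * ε) 0 ((k + 1) / (n + 1)) := by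
    intro k
    induction k with
    | zero => intro hk; simpa using step 0 hk
    | succ k ih =>
      intro hk
      have hstep := step (k + 1) hk
      push_cast at hstep ⊢
      exact (ih (by omega)).trans (by positivity) (by gcongr; linarith) hstep (hr _)
  simpa [div_self hn0.ne'] using key n le_rfl

/-- **Theorem 2.2, first part.** If length spaces `X, Y` sit in a common metric space `Z`
at Hausdorff distance `< D`, with basepoints `x₀ ∈ X`, `y₀ ∈ Y` at distance `< D`, then
every loop `α` in `X` based at `x₀` admits a loop `β` in `Y` based at `y₀` with
`d_Z(α(t), β(t)) < 2D` for all `t`. -/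
theorem exists_close_loop {X Y Z : Type*} [MetricSpace X] [MetricSpace Y] [MetricSpace Z]
    (hX : IsLengthSpace X) (hY : IsLengthSpace Y)
    (fX : X → Z) (fY : Y → Z) (hfX : Isometry fX) (hfY : Isometry fY)
    (D : ℝ) (hD : 0 < D)
    (hH : EMetric.hausdorffEdist (Set.range fX) (Set.range fY) < ENNReal.ofReal D)
    (x₀ : X) (y₀ : Y) (h₀ : dist (fX x₀) (fY y₀) < D)
    (α : Path x₀ x₀) :
    ∃ β : Path y₀ y₀, ∀ t : unitInterval, dist (fX (α t)) (fY (β t)) < 2 * D := by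
  obtain ⟨r, hr₀, hrD, hHr⟩ : ∃ r, dist (fX x₀) (fY y₀) < r ∧ r < D ∧
      Metric.hausdorffEDist (Set.range fX) (Set.range fY) < ENNReal.ofReal r := by
    obtain ⟨r₁, -, h₁, h₁'⟩ := ENNReal.lt_iff_exists_real_btwn.1 hH
    obtain ⟨r₂, h₂, h₂'⟩ := exists_between h₀
    exact ⟨max r₁ r₂, h₂.trans_le (le_max_right ..),
      max_lt ((ENNReal.ofReal_lt_ofReal_iff hD).1 h₁') h₂',
      h₁.trans_le (ENNReal.ofReal_le_ofReal (le_max_left ..))⟩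
  have hclose : ∀ t : ℝ, ∃ y, dist (fX (α.extend t)) (fY y) < r := by
    intro t
    obtain ⟨_, ⟨y, rfl⟩, hy⟩ :=
      Metric.exists_edist_lt_of_hausdorffEDist_lt (mem_range_self (α.extend t)) hHr
    rw [edist_dist] at hy
    exact ⟨y, (ENNReal.ofReal_lt_ofReal_iff (dist_nonneg.trans_lt hr₀)).1 hy⟩
  obtain ⟨β, hβ, h0, h1, hd⟩ := hY.hasCloseLift_of_continuous
    (hfX.continuous.comp α.continuous_extend) hfY (R := 2 * D) (by linarith) hclose y₀ y₀
    (by simpa using hr₀) (by simpa using hr₀)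
  refine ⟨⟨⟨(Icc (0 : ℝ) 1).domRestrict β, hβ.domRestrict⟩, h0, h1⟩, fun t => ?_⟩
  have ht := hd t t.2
  rwa [Function.comp_apply, α.extend_apply t.2] at ht

end
end
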